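/- arXiv:2408.03067 — 4 statements merged into one kernel-verified Lean document; each statement's English description precedes it below -/
import Mathlib

section
/- Let n ≥ 2 and q > 2. Assume f : ℝⁿ → [0,∞) is measurable and satisfies: the mass bound m₀ ≤ ∫_{ℝⁿ} f(v) dv ≤ M₀; the pressure lower bound inf_{σ ∈ S^{n-1}} sup_{e ∈ S^{n-1}, e ⊥ σ} ∫_{ℝⁿ} f(v̄ + w) |w·e|² dw ≥ p₀ > 0, where v̄ := (∫_{ℝⁿ} f(v) v dv)/(∫_{ℝⁿ} f(v) dv); and the moment bound ∫_{ℝⁿ} f(v) |v|^q dv ≤ M_q. Then there exist R ≥ 2 and δ, c > 0, depending only on m₀, M₀, p₀, M_q, and q, such that for every line L ⊂ ℝⁿ (i.e., every set of the form L = {a + t e : t ∈ ℝ} with a ∈ ℝⁿ, e ∈ S^{n-1}), denoting L_δ := {x ∈ ℝⁿ : dist(x, L) < δ}, one has ∫_{B_R \ L_δ} f(w) dw ≥ c, where B_R is the ball of radius R centered at the origin. -/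
open MeasureTheory Metric Set
open scoped ENNReal RealInnerProductSpace NNReal

noncomputable section

/-- `ℝⁿ` -/
abbrev En (n : ℕ) := EuclideanSpace ℝ (Fin n)

/-- The mean velocity `v̄ = (∫ f v dv) / (∫ f dv)`. -/
def vbar {n : ℕ} (f : En n → ℝ) : En n := (∫ v, f v)⁻¹ • ∫ v, f v • v

/-- Mass bounds `m₀ ≤ ∫ f ≤ M₀`. -/
def MassBound {n : ℕ} (f : En n → ℝ) (m₀ M₀ : ℝ) : Prop :=
  ENNReal.ofReal m₀ ≤ (∫⁻ v, ENNReal.ofReal (f v)) ∧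
    (∫⁻ v, ENNReal.ofReal (f v)) ≤ ENNReal.ofReal M₀

/-- Pressure lower bound:
`inf_{σ ∈ S^{n-1}} sup_{e ∈ S^{n-1}, e ⊥ σ} ∫ f(v̄+w) |w·e|² dw ≥ p₀`,
written via the ε-characterization of the supremum. -/
def PressureLB {n : ℕ} (f : En n → ℝ) (p₀ : ℝ) : Prop :=
  ∀ σ : En n, ‖σ‖ = 1 → ∀ ε : ℝ, 0 < ε → ∃ e : En n, ‖e‖ = 1 ∧ ⟪e, σ⟫ = 0 ∧
    ENNReal.ofReal (p₀ - ε) ≤ ∫⁻ w, ENNReal.ofReal (f (vbar f + w) * ⟪w, e⟫ ^ 2)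

/-- Moment bound `∫ f(v) |v|^q dv ≤ M_q`. -/
def MomentBound {n : ℕ} (f : En n → ℝ) (q Mq : ℝ) : Prop :=
  (∫⁻ v, ENNReal.ofReal (f v * ‖v‖ ^ q)) ≤ ENNReal.ofReal Mq

/-- A line orthogonal to a unit vector `e` stays at least `|⟪v - a, e⟫|` away from `v`. -/
lemma abs_inner_sub_le_infDist_line {n : ℕ} {a e σ : En n} (he : ‖e‖ = 1) (heσ : ⟪e, σ⟫ = 0)
    (v : En n) : |⟪v - a, e⟫| ≤ infDist v {y | ∃ t : ℝ, y = a + t • σ} := by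
  refine (le_infDist (s := {y | ∃ t : ℝ, y = a + t • σ}) ⟨a, 0, by simp⟩).2 ?_
  rintro y ⟨t, rfl⟩
  have h : ⟪v - a, e⟫ = ⟪v - (a + t • σ), e⟫ := by
    rw [← sub_sub, inner_sub_left (v - a), inner_smul_left, real_inner_comm e σ, heσ]
    simp
  rw [h, dist_eq_norm]
  simpa [he] using abs_real_inner_le_norm (v - (a + t • σ)) e

/-- A lower-order moment weight is integrable once the mass and a higher moment are. -/
lemma integrable_mul_norm_pow {n : ℕ} {f : En n → ℝ} {q : ℝ} (hf : Measurable f)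
    (hf0 : ∀ v, 0 ≤ f v) (hi : Integrable f) (hiq : Integrable fun v => f v * ‖v‖ ^ q)
    {k : ℕ} (hk : (k : ℝ) ≤ q) : Integrable fun v => f v * ‖v‖ ^ k := by
  refine (hi.add hiq).mono' (by fun_prop) (.of_forall fun v => ?_)
  rw [Real.norm_of_nonneg (mul_nonneg (hf0 v) (by positivity))]
  have h : ‖v‖ ^ k ≤ 1 + ‖v‖ ^ q := by
    rcases le_total ‖v‖ 1 with h1 | h1
    · have := pow_le_one₀ (n := k) (norm_nonneg v) h1
      have := Real.rpow_nonneg (norm_nonneg v) q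
      linarith
    · have := Real.rpow_le_rpow_of_exponent_le h1 hk
      rw [Real.rpow_natCast] at this
      linarith
  have := mul_le_mul_of_nonneg_left h (hf0 v)
  simpa [mul_add] using this

/-- The second moment of `⟪·, e⟫` about the mean velocity is minimal. -/
lemma integral_mul_inner_sub_vbar_sq_le {n : ℕ} {f : En n → ℝ} (hf : Measurable f)
    (hi : Integrable f) (hi1 : Integrable fun v => f v * ‖v‖)
    (hi2 : Integrable fun v => f v * ‖v‖ ^ 2) (hpos : 0 < ∫ v, f v) {e : En n} (he : ‖e‖ = 1)
    (a : En n) :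
    (∀ b : En n, Integrable fun v => f v * ⟪v - b, e⟫ ^ 2) ∧
      ∫ v, f v * ⟪v - vbar f, e⟫ ^ 2 ≤ ∫ v, f v * ⟪v - a, e⟫ ^ 2 := by
  have hle (v : En n) : |⟪v, e⟫| ≤ ‖v‖ := by simpa [he] using abs_real_inner_le_norm v e
  have hv : Integrable fun v => f v • v :=
    hi1.mono (by fun_prop) (.of_forall fun v => by simp [norm_smul])
  have hj1 : Integrable fun v => f v * ⟪v, e⟫ := by
    refine hi1.mono (by fun_prop) (.of_forall fun v => ?_)
    simp only [norm_mul, norm_norm, Real.norm_eq_abs ⟪v, e⟫]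
    gcongr
    exact hle v
  have hj2 : Integrable fun v => f v * ⟪v, e⟫ ^ 2 := by
    refine hi2.mono (by fun_prop) (.of_forall fun v => ?_)
    simp only [norm_mul, norm_pow, norm_norm, Real.norm_eq_abs ⟪v, e⟫]
    gcongr
    exact hle v
  have hexp (b : En n) : (fun v => f v * ⟪v - b, e⟫ ^ 2) =
      fun v => f v * ⟪v, e⟫ ^ 2 - 2 * ⟪b, e⟫ * (f v * ⟪v, e⟫) + ⟪b, e⟫ ^ 2 * f v := by
    funext v
    rw [inner_sub_left]
    ring
  have hval (b : En n) : ∫ v, f v * ⟪v - b, e⟫ ^ 2 =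
      (∫ v, f v * ⟪v, e⟫ ^ 2) - 2 * ⟪b, e⟫ * (∫ v, f v * ⟪v, e⟫) + ⟪b, e⟫ ^ 2 * ∫ v, f v := by
    have hsub : Integrable fun v => f v * ⟪v, e⟫ ^ 2 - 2 * ⟪b, e⟫ * (f v * ⟪v, e⟫) :=
      hj2.sub (hj1.const_mul _)
    rw [hexp b, integral_add hsub (hi.const_mul _), integral_sub hj2 (hj1.const_mul _), integral_const_mul, integral_const_mul]
  have hmean : ⟪vbar f, e⟫ * (∫ v, f v) = ∫ v, f v * ⟪v, e⟫ := by
    have h : ∫ v, f v * ⟪v, e⟫ = ⟪∫ v, f v • v, e⟫ := by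
      rw [real_inner_comm, ← integral_inner (𝕜 := ℝ) hv e]
      simp only [inner_smul_right, real_inner_comm]
    rw [vbar, inner_smul_left, h, conj_trivial]
    field_simp
  refine ⟨fun b => ?_, ?_⟩
  · rw [hexp b]
    exact (hj2.sub (hj1.const_mul _)).add (hi.const_mul _)
  · rw [hval, hval, ← hmean]
    nlinarith [mul_nonneg hpos.le (sq_nonneg (⟪a, e⟫ - ⟪vbar f, e⟫))]

/-- Negative powers of a large radius make a fixed quantity small. -/
lemma exists_radius_rpow_le {m p q : ℝ} (hm : 0 < m) (hp : 0 < p) (hq : 2 < q) (M : ℝ) :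
    ∃ R : ℝ, 2 ≤ R ∧ R ^ (-q) * M ≤ m ∧ R ^ (2 - q) * M ≤ p := by
  have h1 : Filter.Tendsto (fun R : ℝ => R ^ (-q) * M) Filter.atTop (nhds (0 * M)) :=
    (tendsto_rpow_neg_atTop (by linarith)).mul_const M
  have h2 : Filter.Tendsto (fun R : ℝ => R ^ (-(q - 2)) * M) Filter.atTop (nhds (0 * M)) :=
    (tendsto_rpow_neg_atTop (by linarith)).mul_const M
  rw [zero_mul] at h1 h2
  obtain ⟨R, hR, hR1, hR2⟩ := ((Filter.eventually_ge_atTop 2).and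
    ((h1.eventually_le_const hm).and (h2.eventually_le_const hp))).exists
  exact ⟨R, hR, hR1, by simpa using hR2⟩

/-- Moments of order `k ≤ q` outside a ball are controlled by the `q`-th moment. -/
lemma pow_le_rpow_mul_rpow {R x q : ℝ} (hR : 0 < R) (hx : R ≤ x) {k : ℕ} (hk : (k : ℝ) ≤ q) :
    x ^ k ≤ R ^ (k - q) * x ^ q := by
  have hx0 : 0 < x := hR.trans_le hx
  have h : x ^ ((k : ℝ) - q) ≤ R ^ ((k : ℝ) - q) :=
    Real.rpow_le_rpow_of_nonpos hR hx (by linarith)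
  calc x ^ k = x ^ ((k : ℝ) - q) * x ^ q := by
        rw [← Real.rpow_add hx0, sub_add_cancel, Real.rpow_natCast]
    _ ≤ _ := by gcongr

/-- Proposition 3.1 of the paper: under mass, pressure, and `q`-moment bounds
(`q > 2`), there are `R ≥ 2` and `δ, c > 0`, depending only on `m₀, M₀, p₀, M_q, q`, such that
outside any linear tube `L_δ` of radius `δ` a fixed amount `c` of mass lies in `B_R`. -/
theorem stmt3 (m₀ M₀ p₀ Mq q : ℝ) (hm₀ : 0 < m₀) (hp₀ : 0 < p₀) (hq : 2 < q) :
    ∃ R δ c : ℝ, 2 ≤ R ∧ 0 < δ ∧ 0 < c ∧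
      ∀ (n : ℕ), 2 ≤ n → ∀ f : En n → ℝ, Measurable f → (∀ v, 0 ≤ f v) →
        MassBound f m₀ M₀ → PressureLB f p₀ → MomentBound f q Mq →
        ∀ (a e : En n), ‖e‖ = 1 →
          ENNReal.ofReal c ≤
            ∫⁻ w in Metric.ball (0 : En n) R \
              {x | Metric.infDist x {y | ∃ t : ℝ, y = a + t • e} < δ},
              ENNReal.ofReal (f w) := by
  set M := max M₀ 1
  set K := max Mq 0
  have hM1 : 1 ≤ M := le_max_right _ _
  obtain ⟨R, hR, hRm, hRp⟩ := exists_radius_rpow_le (half_pos hm₀)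
    (show 0 < p₀ / 72 by positivity) hq K
  have hR0 : 0 < R := by linarith
  set δ := min 1 (p₀ / (8 * M))
  have hδ0 : 0 < δ := by positivity
  have hδ1 : δ ≤ 1 := min_le_left _ _
  have hδM : δ ^ 2 * M ≤ p₀ / 8 := by
    have h : δ * M ≤ p₀ / 8 := by
      calc δ * M ≤ p₀ / (8 * M) * M := by gcongr; exact min_le_right _ _
        _ = p₀ / 8 := by field_simp
    nlinarith [mul_nonneg hδ0.le (zero_le_one.trans hM1)]
  refine ⟨R, δ, min (m₀ / 2) (p₀ / (36 * R ^ 2)), hR, hδ0, by positivity, ?_⟩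
  rintro n - f hf hf0 ⟨hmass, hmass'⟩ hpr hmom a σ hσ
  have hi : Integrable f :=
    (lintegral_ofReal_ne_top_iff_integrable (by fun_prop) (.of_forall hf0)).1
      (ne_top_of_le_ne_top ENNReal.ofReal_ne_top hmass')
  have hq0 (v : En n) : 0 ≤ f v * ‖v‖ ^ q := mul_nonneg (hf0 v) (by positivity)
  have hiq : Integrable fun v => f v * ‖v‖ ^ q :=
    (lintegral_ofReal_ne_top_iff_integrable (by fun_prop) (.of_forall hq0)).1
      (ne_top_of_le_ne_top ENNReal.ofReal_ne_top hmom)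
  rw [← ofReal_integral_eq_lintegral_ofReal hi (.of_forall hf0)] at hmass hmass'
  have hm : m₀ ≤ ∫ v, f v := (ENNReal.ofReal_le_ofReal_iff (integral_nonneg hf0)).1 hmass
  have hM : ∫ v, f v ≤ M := (ENNReal.ofReal_le_ofReal_iff (by positivity)).1
    (hmass'.trans (ENNReal.ofReal_le_ofReal (le_max_left _ _)))
  have hK : ∫ v, f v * ‖v‖ ^ q ≤ K := by
    rw [MomentBound, ← ofReal_integral_eq_lintegral_ofReal hiq (.of_forall hq0)] at hmom
    exact (ENNReal.ofReal_le_ofReal_iff (le_max_right _ _)).1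
      (hmom.trans (ENNReal.ofReal_le_ofReal (le_max_left _ _)))
  set L : Set (En n) := {y | ∃ t : ℝ, y = a + t • σ}
  set A : Set (En n) := ball 0 R \ {x | infDist x L < δ}
  have hA : MeasurableSet A := measurableSet_ball.diff
    (isOpen_lt (continuous_infDist_pt L) continuous_const).measurableSet
  rw [← ofReal_integral_eq_lintegral_ofReal hi.integrableOn (.of_forall hf0)]
  refine ENNReal.ofReal_le_ofReal ?_
  have hind0 (v : En n) : 0 ≤ A.indicator f v := indicator_nonneg (fun v _ => hf0 v) v
  by_cases hne : ∃ u ∈ ball (0 : En n) R, infDist u L < δ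
  · refine (min_le_right _ _).trans ?_
    obtain ⟨e, he, heσ, hp⟩ := hpr σ hσ (p₀ / 2) (by positivity)
    have hi1 : Integrable fun v => f v * ‖v‖ := by
      simpa using integrable_mul_norm_pow hf hf0 hi hiq (k := 1) (by norm_num; linarith)
    have hi2 : Integrable fun v => f v * ‖v‖ ^ 2 :=
      integrable_mul_norm_pow hf hf0 hi hiq (by norm_num; linarith)
    obtain ⟨hint, hvar⟩ :=
      integral_mul_inner_sub_vbar_sq_le hf hi hi1 hi2 (hm₀.trans_le hm) he a
    have hp' : p₀ / 2 ≤ ∫ v, f v * ⟪v - vbar f, e⟫ ^ 2 := by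
      have hsq (v : En n) : 0 ≤ f v * ⟪v - vbar f, e⟫ ^ 2 := mul_nonneg (hf0 v) (sq_nonneg _)
      have htr := lintegral_add_left_eq_self (μ := (volume : Measure (En n)))
        (fun v => ENNReal.ofReal (f v * ⟪v - vbar f, e⟫ ^ 2)) (vbar f)
      simp only [add_sub_cancel_left] at htr
      rw [htr, ← ofReal_integral_eq_lintegral_ofReal (hint _) (.of_forall hsq)] at hp
      have := (ENNReal.ofReal_le_ofReal_iff (integral_nonneg hsq)).1 hp
      linarith
    obtain ⟨u, hu, huL⟩ := hne
    have hdist (v : En n) : |⟪v - a, e⟫| ≤ infDist v L := abs_inner_sub_le_infDist_line he heσ v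
    have hinner (v : En n) : |⟪v, e⟫| ≤ ‖v‖ := by simpa [he] using abs_real_inner_le_norm v e
    have hfar (v : En n) : |⟪v - a, e⟫| ≤ ‖v‖ + R + 1 := by
      have h1 := hdist u
      have h2 := hinner u
      have h3 := hinner v
      rw [mem_ball_zero_iff] at hu
      rw [inner_sub_left] at h1 ⊢
      rw [abs_le] at *
      constructor <;> linarith
    have hpt (v : En n) : f v * ⟪v - a, e⟫ ^ 2 ≤
        δ ^ 2 * f v + 9 * R ^ 2 * A.indicator f v + 9 * R ^ (2 - q) * (f v * ‖v‖ ^ q) := by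
      have hn1 := mul_nonneg (sq_nonneg δ) (hf0 v)
      have hn2 := mul_nonneg (show 0 ≤ 9 * R ^ 2 by positivity) (hind0 v)
      have hn3 := mul_nonneg (show 0 ≤ 9 * R ^ (2 - q) by positivity) (hq0 v)
      rcases lt_or_ge ‖v‖ R with hvR | hvR
      · by_cases hvL : infDist v L < δ
        · have h : ⟪v - a, e⟫ ^ 2 ≤ δ ^ 2 := by
            rw [← sq_abs]
            gcongr
            exact (hdist v).trans hvL.le
          have := mul_le_mul_of_nonneg_left h (hf0 v)
          linarith
        · have h : ⟪v - a, e⟫ ^ 2 ≤ (3 * R) ^ 2 := by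
            rw [← sq_abs]
            gcongr
            linarith [hfar v]
          have hvA : v ∈ A := ⟨by simpa using hvR, hvL⟩
          rw [indicator_of_mem hvA] at *
          have := mul_le_mul_of_nonneg_left h (hf0 v)
          linarith
      · have h : ⟪v - a, e⟫ ^ 2 ≤ (3 * ‖v‖) ^ 2 := by
          rw [← sq_abs]
          gcongr
          linarith [hfar v]
        have h' : ‖v‖ ^ 2 ≤ R ^ (2 - q) * ‖v‖ ^ q := by
          exact_mod_cast pow_le_rpow_mul_rpow hR0 hvR (k := 2) (by norm_num; linarith)
        have := mul_le_mul_of_nonneg_left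
          (show ⟪v - a, e⟫ ^ 2 ≤ 9 * (R ^ (2 - q) * ‖v‖ ^ q) by nlinarith) (hf0 v)
        linarith
    have hsum : Integrable fun v =>
        δ ^ 2 * f v + 9 * R ^ 2 * A.indicator f v :=
      (hi.const_mul _).add ((hi.indicator hA).const_mul _)
    have key := integral_mono (hint a) (hsum.add (hiq.const_mul (9 * R ^ (2 - q)))) hpt
    simp only [Pi.add_apply] at key
    rw [integral_add hsum (hiq.const_mul _),
      integral_add (hi.const_mul _) ((hi.indicator hA).const_mul _), integral_const_mul,
      integral_const_mul, integral_const_mul, integral_indicator hA] at key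
    have b1 : δ ^ 2 * ∫ v, f v ≤ δ ^ 2 * M := by gcongr
    have b2 : R ^ (2 - q) * ∫ v, f v * ‖v‖ ^ q ≤ R ^ (2 - q) * K := by gcongr
    rw [div_le_iff₀ (by positivity)]
    linarith
  · refine (min_le_left _ _).trans ?_
    have hpt (v : En n) : f v ≤ A.indicator f v + R ^ (-q) * (f v * ‖v‖ ^ q) := by
      rcases lt_or_ge ‖v‖ R with hvR | hvR
      · have hv : v ∈ ball (0 : En n) R := by simpa using hvR
        have hvA : v ∈ A := ⟨hv, fun h => hne ⟨v, hv, h⟩⟩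
        rw [indicator_of_mem hvA]
        have := mul_nonneg (show 0 ≤ R ^ (-q) by positivity) (hq0 v)
        linarith
      · have h := pow_le_rpow_mul_rpow hR0 hvR (k := 0) (q := q) (by norm_num; linarith)
        simp only [pow_zero, Nat.cast_zero, zero_sub] at h
        have := mul_le_mul_of_nonneg_left h (hf0 v)
        linarith [hind0 v]
    have key := integral_mono hi ((hi.indicator hA).add (hiq.const_mul (R ^ (-q)))) hpt
    simp only [Pi.add_apply] at key
    rw [integral_add (hi.indicator hA) (hiq.const_mul _), integral_const_mul,
      integral_indicator hA] at key
    have b : R ^ (-q) * ∫ v, f v * ‖v‖ ^ q ≤ R ^ (-q) * K := by gcongr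
    linarith
end
end

section
/- Let n ≥ 2 and q > 2. Assume f : ℝⁿ → [0,∞) is measurable and satisfies: the mass bound m₀ ≤ ∫_{ℝⁿ} f(v) dv ≤ M₀; the pressure lower bound inf_{σ ∈ S^{n-1}} sup_{e ∈ S^{n-1}, e ⊥ σ} ∫_{ℝⁿ} f(v̄ + w) |w·e|² dw ≥ p₀ > 0, where v̄ := (∫_{ℝⁿ} f(v) v dv)/(∫_{ℝⁿ} f(v) dv); and the moment bound ∫_{ℝⁿ} f(v) |v|^q dv ≤ M_q. Then there exist R, λ > 0 depending only on m₀, M₀, p₀, M_q, q, and δ₀ ∈ (0,1) depending only on M₀ and p₀, such that for every σ ∈ S^{n-1}: ∫_{B_R ∩ {w : dist(w, ⟨σ⟩) ≥ δ₀}} f(v̄ + w) dw ≥ λ, where ⟨σ⟩ := {t σ : t ∈ ℝ} is the line spanned by σ and B_R is the ball of radius R centered at the origin. -/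
open MeasureTheory Metric Set
open scoped ENNReal RealInnerProductSpace NNReal

noncomputable section

/-- A `q`-moment bound with `q ≥ 1` and a lower mass bound control the mean velocity. -/
theorem norm_vbar_le {n : ℕ} {f : En n → ℝ} (hf : Measurable f) (hf0 : ∀ v, 0 ≤ f v)
    {m A M q : ℝ} (hm : 0 < m) (hA : 0 ≤ A) (hM : 0 ≤ M) (hq : 1 ≤ q)
    (hmass : MassBound f m A) (hmom : MomentBound f q M) :
    ‖vbar f‖ ≤ m⁻¹ * (A + M) := by
  have hint : ∫ v, f v = (∫⁻ v, ENNReal.ofReal (f v)).toReal :=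
    integral_eq_lintegral_of_nonneg_ae (Filter.Eventually.of_forall hf0)
      hf.aestronglyMeasurable
  have hmI : m ≤ ∫ v, f v := by
    rw [hint]
    exact (ENNReal.ofReal_le_iff_le_toReal
      (hmass.2.trans_lt ENNReal.ofReal_lt_top).ne).1 hmass.1
  have hnum : ‖∫ v, f v • v‖ ≤ A + M := by
    refine (norm_integral_le_lintegral_norm _).trans ?_
    refine ENNReal.toReal_le_of_le_ofReal (by positivity) ?_
    rw [ENNReal.ofReal_add hA hM]
    calc ∫⁻ v, ENNReal.ofReal ‖f v • v‖
        ≤ ∫⁻ v, (ENNReal.ofReal (f v) + ENNReal.ofReal (f v * ‖v‖ ^ q)) := by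
          refine lintegral_mono fun v => ?_
          have hv : 0 ≤ f v * ‖v‖ ^ q := mul_nonneg (hf0 v) (by positivity)
          rw [← ENNReal.ofReal_add (hf0 v) hv]
          refine ENNReal.ofReal_le_ofReal ?_
          rw [norm_smul, Real.norm_of_nonneg (hf0 v)]
          have key : ‖v‖ ≤ 1 + ‖v‖ ^ q := by
            rcases le_total ‖v‖ 1 with h | h
            · have : 0 ≤ ‖v‖ ^ q := by positivity
              linarith
            · linarith [Real.self_le_rpow_of_one_le h hq]
          nlinarith [mul_le_mul_of_nonneg_left key (hf0 v)]
      _ = (∫⁻ v, ENNReal.ofReal (f v)) + ∫⁻ v, ENNReal.ofReal (f v * ‖v‖ ^ q) :=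
          lintegral_add_left hf.ennreal_ofReal _
      _ ≤ _ := add_le_add hmass.2 hmom
  rw [vbar, norm_smul, norm_inv, Real.norm_of_nonneg (hm.le.trans hmI)]
  gcongr

theorem abs_inner_le_infDist_span {E : Type*} [NormedAddCommGroup E] [InnerProductSpace ℝ E]
    {e σ : E} (he : ‖e‖ = 1) (heσ : ⟪e, σ⟫ = 0) (w : E) :
    |⟪w, e⟫| ≤ infDist w {y : E | ∃ t : ℝ, y = t • σ} := by
  have hne : {y : E | ∃ t : ℝ, y = t • σ}.Nonempty := ⟨0, 0, by simp⟩
  refine (le_infDist hne).2 ?_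
  rintro _ ⟨t, rfl⟩
  have h : ⟪w, e⟫ = ⟪w - t • σ, e⟫ := by
    rw [inner_sub_left, inner_smul_left, real_inner_comm e σ, heσ]
    simp
  rw [h, dist_eq_norm]
  simpa [he] using abs_real_inner_le_norm (w - t • σ) e

theorem sq_le_rpow_mul_rpow {R x q : ℝ} (hR : 0 < R) (hx : R ≤ x) (hq : 2 ≤ q) :
    x ^ 2 ≤ R ^ (2 - q) * x ^ q := by
  have hx0 : 0 < x := hR.trans_le hx
  have h1 : x ^ 2 = x ^ (2 - q) * x ^ q := by
    rw [← Real.rpow_add hx0, sub_add_cancel, Real.rpow_two]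
  rw [h1]
  exact mul_le_mul_of_nonneg_right
    (Real.rpow_le_rpow_of_nonpos hR hx (by linarith)) (by positivity)

theorem add_rpow_le_two_rpow_mul {a b q : ℝ} (ha : 0 ≤ a) (hb : 0 ≤ b) (hq : 0 ≤ q) :
    (a + b) ^ q ≤ 2 ^ q * (a ^ q + b ^ q) := by
  have hab : (a + b) ^ q ≤ (2 * max a b) ^ q := by
    refine Real.rpow_le_rpow (by positivity) ?_ hq
    linarith [le_max_left a b, le_max_right a b]
  refine hab.trans ?_
  rw [Real.mul_rpow (by norm_num) (ha.trans (le_max_left a b))]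
  gcongr
  have := Real.rpow_nonneg ha q
  have := Real.rpow_nonneg hb q
  rcases max_cases a b with h | h <;> rw [h.1] <;> linarith

theorem exists_pos_rpow_two_sub_mul_le {q : ℝ} (hq : 2 < q) (C : ℝ) {p : ℝ} (hp : 0 < p) :
    ∃ R : ℝ, 0 < R ∧ R ^ (2 - q) * C ≤ p := by
  have h := (tendsto_rpow_neg_atTop (sub_pos.2 hq)).mul_const C
  rw [zero_mul, neg_sub] at h
  obtain ⟨R, hR, hR0⟩ := ((h.eventually_le_const hp).and (Filter.eventually_gt_atTop 0)).exists
  exact ⟨R, hR0, hR⟩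

/-- Lemma 3.4 of the paper: under mass, pressure, and `q`-moment bounds
(`q > 2`), there are `δ₀ ∈ (0,1)` depending only on `M₀, p₀`, and `R, λ > 0` depending only on
`m₀, M₀, p₀, M_q, q`, such that for every unit `σ` a fixed amount of mass `λ` lies in
`B_R ∩ {dist(·, ⟨σ⟩) ≥ δ₀}` (relative to the center of mass `v̄`). -/
theorem stmt5 (M₀ p₀ : ℝ) (hp₀ : 0 < p₀) :
    ∃ δ₀ : ℝ, δ₀ ∈ Set.Ioo (0:ℝ) 1 ∧
      ∀ m₀ Mq q : ℝ, 0 < m₀ → 2 < q →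
        ∃ R lam : ℝ, 0 < R ∧ 0 < lam ∧
          ∀ (n : ℕ), 2 ≤ n → ∀ f : En n → ℝ, Measurable f → (∀ v, 0 ≤ f v) →
            MassBound f m₀ M₀ → PressureLB f p₀ → MomentBound f q Mq →
            ∀ σ : En n, ‖σ‖ = 1 →
              ENNReal.ofReal lam ≤
                ∫⁻ w in Metric.ball (0 : En n) R ∩
                  {w | δ₀ ≤ Metric.infDist w {y : En n | ∃ t : ℝ, y = t • σ}},
                  ENNReal.ofReal (f (vbar f + w)) := by
  set A := max M₀ 1 with hA
  have hA1 : 1 ≤ A := le_max_right _ _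
  have hA0 : 0 < A := by linarith
  refine ⟨min (1 / 2) (p₀ / (4 * A)), ⟨by positivity, ?_⟩, ?_⟩
  · exact (min_le_left _ _).trans_lt (by norm_num)
  set δ := min (1 / 2) (p₀ / (4 * A)) with hδ
  have hδ0 : 0 < δ := by positivity
  have hδA : δ ^ 2 * A ≤ p₀ / 4 := by
    have h1 : δ ≤ 1 / 2 := min_le_left _ _
    have h2 : δ * (4 * A) ≤ p₀ := (le_div_iff₀ (by positivity)).1 (min_le_right _ _)
    nlinarith [mul_nonneg hδ0.le hA0.le]
  intro m₀ Mq q hm₀ hq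
  set M := max Mq 0 with hM
  have hM0 : 0 ≤ M := le_max_right _ _
  set B := m₀⁻¹ * (A + M) with hB
  have hB0 : 0 ≤ B := by positivity
  obtain ⟨R, hR0, hR⟩ := exists_pos_rpow_two_sub_mul_le hq (2 ^ q * (M + B ^ q * A))
    (show 0 < p₀ / 4 by positivity)
  refine ⟨R, p₀ / 4 / R ^ 2, hR0, by positivity, ?_⟩
  intro n _ f hf hf0 hmass hpres hmom σ hσ
  replace hmass : MassBound f m₀ A :=
    ⟨hmass.1, hmass.2.trans (ENNReal.ofReal_le_ofReal (le_max_left _ _))⟩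
  replace hmom : MomentBound f q M :=
    hmom.trans (ENNReal.ofReal_le_ofReal (le_max_left _ _))
  have hv := norm_vbar_le hf hf0 hm₀ hA0.le hM0 (by linarith) hmass hmom
  obtain ⟨e, he, heσ, hp⟩ := hpres σ hσ (p₀ / 4) (by positivity)
  set G := ball (0 : En n) R ∩ {w | δ ≤ infDist w {y : En n | ∃ t : ℝ, y = t • σ}} with hG
  have hGm : MeasurableSet G :=
    measurableSet_ball.inter (measurableSet_le measurable_const measurable_infDist)
  set K := R ^ (2 - q) * 2 ^ q with hK
  have hK0 : 0 ≤ K := by positivity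
  have hc0 : 0 ≤ δ ^ 2 + K * B ^ q := by positivity
  have hF : Measurable fun w => ENNReal.ofReal (f (vbar f + w)) :=
    (hf.comp (measurable_const_add _)).ennreal_ofReal
  have hFmass : ∫⁻ w, ENNReal.ofReal (f (vbar f + w)) = ∫⁻ v, ENNReal.ofReal (f v) :=
    lintegral_add_left_eq_self (fun v => ENNReal.ofReal (f v)) (vbar f)
  have hFmom : ∫⁻ w, ENNReal.ofReal (f (vbar f + w) * ‖vbar f + w‖ ^ q) =
      ∫⁻ v, ENNReal.ofReal (f v * ‖v‖ ^ q) :=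
    lintegral_add_left_eq_self (fun v => ENNReal.ofReal (f v * ‖v‖ ^ q)) (vbar f)
  have hpt : ∀ w, ENNReal.ofReal (f (vbar f + w) * ⟪w, e⟫ ^ 2) ≤
      ENNReal.ofReal (R ^ 2) * G.indicator (fun w => ENNReal.ofReal (f (vbar f + w))) w +
      (ENNReal.ofReal (δ ^ 2 + K * B ^ q) * ENNReal.ofReal (f (vbar f + w)) +
        ENNReal.ofReal K * ENNReal.ofReal (f (vbar f + w) * ‖vbar f + w‖ ^ q)) := by
    intro w
    have hfw := hf0 (vbar f + w)
    have hwe : |⟪w, e⟫| ≤ ‖w‖ := by simpa [he] using abs_real_inner_le_norm w e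
    by_cases hw : w ∈ G
    · refine le_add_right ?_
      rw [indicator_of_mem hw, ← ENNReal.ofReal_mul (by positivity), mul_comm (R ^ 2)]
      have hwR : ‖w‖ < R := mem_ball_zero_iff.1 hw.1
      have h2 : ⟪w, e⟫ ^ 2 ≤ R ^ 2 := sq_le_sq' (by linarith [neg_abs_le ⟪w, e⟫])
        (by linarith [le_abs_self ⟪w, e⟫])
      gcongr
    · refine le_add_left ?_
      rw [← ENNReal.ofReal_mul hc0, ← ENNReal.ofReal_mul hK0,
        ← ENNReal.ofReal_add (by positivity) (by positivity)]
      refine ENNReal.ofReal_le_ofReal ?_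
      suffices h : ⟪w, e⟫ ^ 2 ≤ δ ^ 2 + K * B ^ q + K * ‖vbar f + w‖ ^ q by
        linarith [mul_le_mul_of_nonneg_left h hfw]
      by_cases hwR : ‖w‖ < R
      · have hd : |⟪w, e⟫| ≤ δ := (abs_inner_le_infDist_span he heσ w).trans
          (not_le.1 fun h => hw ⟨mem_ball_zero_iff.2 hwR, h⟩).le
        have h2 : ⟪w, e⟫ ^ 2 ≤ δ ^ 2 := sq_le_sq' (by linarith [neg_abs_le ⟪w, e⟫])
          (by linarith [le_abs_self ⟪w, e⟫])
        have h3 : 0 ≤ K * B ^ q := by positivity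
        have h4 : 0 ≤ K * ‖vbar f + w‖ ^ q := by positivity
        linarith
      · have h1 : ⟪w, e⟫ ^ 2 ≤ ‖w‖ ^ 2 := sq_le_sq' (by linarith [neg_abs_le ⟪w, e⟫])
          (by linarith [le_abs_self ⟪w, e⟫])
        have h2 := sq_le_rpow_mul_rpow hR0 (not_lt.1 hwR) hq.le
        have h3 : ‖w‖ ≤ ‖vbar f + w‖ + B := by
          have := norm_sub_le (vbar f + w) (vbar f)
          rw [add_sub_cancel_left] at this
          linarith
        have h4 : ‖w‖ ^ q ≤ 2 ^ q * (‖vbar f + w‖ ^ q + B ^ q) :=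
          (Real.rpow_le_rpow (norm_nonneg _) h3 (by linarith)).trans
            (add_rpow_le_two_rpow_mul (norm_nonneg _) hB0 (by linarith))
        have h5 := mul_le_mul_of_nonneg_left h4 (Real.rpow_nonneg hR0.le (2 - q))
        rw [← mul_assoc, ← hK] at h5
        nlinarith [sq_nonneg δ]
  have hrest : ENNReal.ofReal (δ ^ 2 + K * B ^ q) * ENNReal.ofReal A +
      ENNReal.ofReal K * ENNReal.ofReal M ≤ ENNReal.ofReal (p₀ / 2) := by
    rw [← ENNReal.ofReal_mul hc0, ← ENNReal.ofReal_mul hK0,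
      ← ENNReal.ofReal_add (by positivity) (by positivity)]
    refine ENNReal.ofReal_le_ofReal ?_
    rw [← mul_assoc, ← hK] at hR
    linarith
  have hmain : ENNReal.ofReal (p₀ - p₀ / 4) ≤
      ENNReal.ofReal (R ^ 2) * (∫⁻ w in G, ENNReal.ofReal (f (vbar f + w))) +
        ENNReal.ofReal (p₀ / 2) := by
    refine (hp.trans (lintegral_mono hpt)).trans ?_
    rw [lintegral_add_left ((hF.indicator hGm).const_mul _),
      lintegral_add_left (hF.const_mul _), lintegral_const_mul _ (hF.indicator hGm),
      lintegral_const_mul _ hF, lintegral_const_mul' _ _ ENNReal.ofReal_ne_top,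
      lintegral_indicator hGm, hFmass, hFmom]
    refine add_le_add le_rfl (le_trans ?_ hrest)
    gcongr
    · exact hmass.2
    · exact hmom
  by_contra! hlt
  have hlt' : ENNReal.ofReal (R ^ 2) * (∫⁻ w in G, ENNReal.ofReal (f (vbar f + w))) <
      ENNReal.ofReal (p₀ / 4) := by
    have h : p₀ / 4 = R ^ 2 * (p₀ / 4 / R ^ 2) := by field_simp
    rw [h, ENNReal.ofReal_mul (by positivity)]
    exact ENNReal.mul_lt_mul_right (ENNReal.ofReal_pos.2 (by positivity)).ne'
      ENNReal.ofReal_ne_top hlt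
  have := hmain.trans_lt (ENNReal.add_lt_add_right ENNReal.ofReal_ne_top hlt')
  rw [← ENNReal.ofReal_add (by positivity) (by positivity)] at this
  exact absurd this (not_lt.2 (ENNReal.ofReal_le_ofReal (by linarith)))
end
end

section
/- Let n ≥ 2. Assume f : ℝⁿ → [0,∞) is measurable with m₀ ≤ ∫_{ℝⁿ} f(v) dv ≤ M₀, with first moment ∫_{ℝⁿ} f(v)|v| dv ≤ M₁ and energy (1/2)∫_{ℝⁿ} f(v)|v|² dv ≤ E₀, and let v̄ := (∫_{ℝⁿ} f(v) v dv)/(∫_{ℝⁿ} f(v) dv). Suppose there exist η, λ₁ > 0 and e₀ ∈ S^{n-1} such that ∫_{{w ∈ ℝⁿ : w·e₀ ≥ η}} f(v̄ + w) dw ≥ λ₁. Then there exist ϱ, λ₂ > 0, depending only on λ₁, η, m₀, M₁, E₀, such that ∫_{B_ϱ ∩ {w : w·e₀ ≤ 0}} f(v̄ + w) dw ≥ λ₂, where B_ϱ is the ball of radius ϱ centered at the origin. -/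
open MeasureTheory Metric Set
open scoped ENNReal RealInnerProductSpace NNReal

noncomputable section

section Helpers

variable {E : Type*} [NormedAddCommGroup E] [InnerProductSpace ℝ E] [MeasurableSpace E]
  {μ : Measure E}

/-- A measurable nonnegative function whose lower integral is at most `ENNReal.ofReal C` is
integrable. -/
theorem integrable_of_lintegral_ofReal_le {α : Type*} [MeasurableSpace α] {μ : Measure α}
    {g : α → ℝ} {C : ℝ} (hg : AEStronglyMeasurable g μ) (h0 : ∀ x, 0 ≤ g x)
    (h : ∫⁻ x, ENNReal.ofReal (g x) ∂μ ≤ ENNReal.ofReal C) : Integrable g μ :=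
  (lintegral_ofReal_ne_top_iff_integrable hg (.of_forall h0)).1
    (h.trans_lt ENNReal.ofReal_lt_top).ne

/-- For a density `g` with vanishing first moment in direction `e`, mass in `{η ≤ ⟪w, e⟫}` is
balanced by mass in `{⟪w, e⟫ ≤ 0}` near the origin, up to a second moment tail. -/
theorem mul_setIntegral_le_of_integral_inner_eq_zero [BorelSpace E] {g : E → ℝ}
    (h0 : ∀ w, 0 ≤ g w) (hg : Integrable g μ) {e : E} (he : ‖e‖ = 1)
    (hg1 : Integrable (fun w => g w * ⟪w, e⟫) μ) (hg2 : Integrable (fun w => g w * ‖w‖ ^ 2) μ)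
    (hmean : ∫ w, g w * ⟪w, e⟫ ∂μ = 0) (η : ℝ) {r : ℝ} (hr : 0 < r) :
    η * ∫ w in {w | η ≤ ⟪w, e⟫}, g w ∂μ ≤
      r * (∫ w in ball 0 r ∩ {w | ⟪w, e⟫ ≤ 0}, g w ∂μ) + r⁻¹ * ∫ w, g w * ‖w‖ ^ 2 ∂μ := by
  have hcont : Continuous fun w : E => ⟪w, e⟫ := by fun_prop
  have hA : MeasurableSet {w : E | η ≤ ⟪w, e⟫} :=
    (isClosed_le continuous_const hcont).measurableSet
  have hB : MeasurableSet (ball (0 : E) r ∩ {w : E | ⟪w, e⟫ ≤ 0}) :=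
    isOpen_ball.measurableSet.inter (isClosed_le hcont continuous_const).measurableSet
  have hiB := (hg.indicator hB).const_mul r
  have hi2 := hg2.const_mul r⁻¹
  rw [← integral_indicator hA, ← integral_indicator hB, ← integral_const_mul,
    ← integral_const_mul, ← integral_const_mul, ← integral_add hiB hi2]
  have hsplit := integral_add hg1 (hiB.add hi2)
  rw [hmean, zero_add] at hsplit
  refine (integral_mono ((hg.indicator hA).const_mul η) (hg1.add (hiB.add hi2))
    fun w => ?_).trans_eq hsplit
  have hgw := h0 w
  have hcs : -‖w‖ ≤ ⟪w, e⟫ := by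
    have := neg_le_of_abs_le (abs_real_inner_le_norm w e)
    rwa [he, mul_one] at this
  have hT : 0 ≤ r⁻¹ * (g w * ‖w‖ ^ 2) := by positivity
  have hBn : 0 ≤ r * (ball (0 : E) r ∩ {w : E | ⟪w, e⟫ ≤ 0}).indicator g w :=
    mul_nonneg hr.le (indicator_nonneg (fun w _ => h0 w) w)
  simp only [Pi.add_apply]
  have key : 0 ≤ g w * ⟪w, e⟫ + (r * (ball (0 : E) r ∩ {w : E | ⟪w, e⟫ ≤ 0}).indicator g w +
      r⁻¹ * (g w * ‖w‖ ^ 2)) := by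
    rcases lt_or_ge 0 ⟪w, e⟫ with hpos | hneg
    · have := mul_nonneg hgw hpos.le
      linarith
    rcases lt_or_ge ‖w‖ r with hwr | hwr
    · have hmem : w ∈ ball (0 : E) r ∩ {w : E | ⟪w, e⟫ ≤ 0} := ⟨by simpa using hwr, hneg⟩
      rw [indicator_of_mem hmem]
      have := mul_nonneg hgw (by linarith : 0 ≤ ⟪w, e⟫ + r)
      linarith
    · have h1 : ‖w‖ ≤ r⁻¹ * ‖w‖ ^ 2 := by
        rw [inv_mul_eq_div, le_div_iff₀ hr, sq]
        gcongr
      have := mul_nonneg hgw (by linarith : 0 ≤ ⟪w, e⟫ + r⁻¹ * ‖w‖ ^ 2)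
      linarith
  by_cases hw : w ∈ {w : E | η ≤ ⟪w, e⟫}
  · rw [indicator_of_mem hw]
    have := mul_le_mul_of_nonneg_left (by simpa using hw : η ≤ ⟪w, e⟫) hgw
    linarith
  · rw [indicator_of_notMem hw, mul_zero]
    exact key

variable {f : E → ℝ} {c : E}

/-- The first moment about the center of mass vanishes. -/
theorem integral_mul_inner_sub_eq_zero [CompleteSpace E] (hf : Integrable f μ)
    (hf1 : Integrable (fun v => f v • v) μ)
    (hc : ∫ v, f v • v ∂μ = (∫ v, f v ∂μ) • c) (e : E) :
    ∫ v, f v * ⟪v - c, e⟫ ∂μ = 0 := by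
  have h : ∀ v, f v * ⟪v - c, e⟫ = ⟪e, f v • v - f v • c⟫ := fun v => by
    rw [← smul_sub, inner_smul_right, real_inner_comm]
  simp_rw [h]
  refine (integral_inner (hf1.sub (hf.smul_const c)) e).trans ?_
  simp only [Pi.sub_apply]
  rw [integral_sub hf1 (hf.smul_const c), integral_smul_const, hc, sub_self, inner_zero_right]

theorem integrable_mul_norm_sub_sq (hf : Integrable f μ) (hf1 : Integrable (fun v => f v • v) μ)
    (hf2 : Integrable (fun v => f v * ‖v‖ ^ 2) μ) (c : E) :
    Integrable (fun v => f v * ‖v - c‖ ^ 2) μ := by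
  refine ((hf2.sub ((hf1.const_inner c).const_mul 2)).add (hf.mul_const (‖c‖ ^ 2))).congr
    (.of_forall fun v => ?_)
  simp only [Pi.add_apply, Pi.sub_apply, norm_sub_sq_real, inner_smul_right, real_inner_comm v c]
  ring

/-- The second moment about the center of mass is at most the second moment. -/
theorem integral_mul_norm_sub_sq_le [CompleteSpace E] (h0 : ∀ v, 0 ≤ f v) (hf : Integrable f μ)
    (hf1 : Integrable (fun v => f v • v) μ) (hf2 : Integrable (fun v => f v * ‖v‖ ^ 2) μ)
    (hc : ∫ v, f v • v ∂μ = (∫ v, f v ∂μ) • c) :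
    ∫ v, f v * ‖v - c‖ ^ 2 ∂μ ≤ ∫ v, f v * ‖v‖ ^ 2 ∂μ := by
  have h : ∀ v, f v * ‖v - c‖ ^ 2 =
      f v * ‖v‖ ^ 2 - 2 * (f v * ⟪v - c, c⟫) - f v * ‖c‖ ^ 2 := fun v => by
    rw [norm_sub_sq_real, inner_sub_left, real_inner_self_eq_norm_sq]
    ring
  have hi : Integrable (fun v => f v * ⟪v - c, c⟫) μ :=
    ((hf1.sub (hf.smul_const c)).const_inner c).congr (.of_forall fun v => by
      simp only [Pi.sub_apply]
      rw [← smul_sub, inner_smul_right, real_inner_comm])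
  simp_rw [h]
  refine (integral_sub (hf2.sub (hi.const_mul 2)) (hf.mul_const _)).trans_le ?_
  simp only [Pi.sub_apply]
  rw [integral_sub hf2 (hi.const_mul 2),
    integral_const_mul, integral_mul_inner_sub_eq_zero hf hf1 hc, integral_mul_const]
  have := mul_nonneg (integral_nonneg (μ := μ) h0) (sq_nonneg ‖c‖)
  linarith

end Helpers

/-- Lemma 3.5 of the paper: if a fixed amount of mass `λ₁` lies in the
half-space `{w·e₀ ≥ η}` (relative to the center of mass `v̄`), then a fixed amount of mass `λ₂`
lies in `B_ϱ ∩ {w·e₀ ≤ 0}`, with `ϱ, λ₂` depending only on `λ₁, η, m₀, M₁, E₀`. -/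
theorem stmt6 (lam₁ η m₀ M₁ E₀ : ℝ) (hlam₁ : 0 < lam₁) (hη : 0 < η) (hm₀ : 0 < m₀) :
    ∃ ϱ lam₂ : ℝ, 0 < ϱ ∧ 0 < lam₂ ∧
      ∀ (n : ℕ), 2 ≤ n → ∀ M₀ : ℝ, ∀ f : En n → ℝ, Measurable f → (∀ v, 0 ≤ f v) →
        MassBound f m₀ M₀ →
        (∫⁻ v, ENNReal.ofReal (f v * ‖v‖)) ≤ ENNReal.ofReal M₁ →
        (∫⁻ v, ENNReal.ofReal (f v * ‖v‖ ^ 2)) ≤ ENNReal.ofReal (2 * E₀) →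
        ∀ e₀ : En n, ‖e₀‖ = 1 →
          ENNReal.ofReal lam₁ ≤
            (∫⁻ w in {w : En n | η ≤ ⟪w, e₀⟫}, ENNReal.ofReal (f (vbar f + w))) →
          ENNReal.ofReal lam₂ ≤
            ∫⁻ w in Metric.ball (0 : En n) ϱ ∩ {w : En n | ⟪w, e₀⟫ ≤ 0},
              ENNReal.ofReal (f (vbar f + w)) := by
  have hd : 0 < η * lam₁ := mul_pos hη hlam₁
  set r : ℝ := 4 * |E₀| / (η * lam₁) + 1 with hr_def
  have hr : 0 < r := by positivity
  refine ⟨r, η * lam₁ / (2 * r), hr, by positivity, ?_⟩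
  intro n _ M₀ f hf h0 hmass hmom henergy e he hlam
  have hfi : Integrable f := integrable_of_lintegral_ofReal_le hf.aestronglyMeasurable h0 hmass.2
  have hf1 : Integrable (fun v => f v • v) := by
    refine (integrable_norm_iff (by fun_prop)).1 ?_
    refine (integrable_of_lintegral_ofReal_le (g := fun v => f v * ‖v‖) (by fun_prop)
      (fun v => mul_nonneg (h0 v) (norm_nonneg v)) hmom).congr (.of_forall fun v => ?_)
    simp only [norm_smul, Real.norm_of_nonneg (h0 v)]
  have h0sq : ∀ v, 0 ≤ f v * ‖v‖ ^ 2 := fun v => mul_nonneg (h0 v) (sq_nonneg _)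
  have hf2 : Integrable (fun v => f v * ‖v‖ ^ 2) :=
    integrable_of_lintegral_ofReal_le (by fun_prop) h0sq henergy
  have hE : ∫ v, f v * ‖v‖ ^ 2 ≤ 2 * |E₀| := by
    rw [← ofReal_integral_eq_lintegral_ofReal hf2 (.of_forall h0sq)] at henergy
    refine (ENNReal.ofReal_le_ofReal_iff (by positivity)).1 (henergy.trans ?_)
    exact ENNReal.ofReal_le_ofReal (by linarith [le_abs_self E₀])
  have hm : 0 < ∫ v, f v := by
    have h := hmass.1
    rw [← ofReal_integral_eq_lintegral_ofReal hfi (.of_forall h0)] at h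
    exact ENNReal.ofReal_pos.1 ((ENNReal.ofReal_pos.2 hm₀).trans_le h)
  have hc : ∫ v, f v • v = (∫ v, f v) • vbar f := (smul_inv_smul₀ hm.ne' _).symm
  have hg0 : ∀ w, 0 ≤ f (vbar f + w) := fun w => h0 _
  have hg : Integrable (fun w => f (vbar f + w)) := hfi.comp_add_left _
  have hshift1 : Integrable (fun w => f (vbar f + w) * ⟪w, e⟫) := by
    refine (((hf1.sub (hfi.smul_const (vbar f))).const_inner e).comp_add_left (vbar f)).congr
      (.of_forall fun w => ?_)
    simp only [Pi.sub_apply]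
    rw [← smul_sub, inner_smul_right, add_sub_cancel_left, real_inner_comm]
  have hshift2 : Integrable (fun w => f (vbar f + w) * ‖w‖ ^ 2) := by
    simpa only [add_sub_cancel_left] using
      (integrable_mul_norm_sub_sq hfi hf1 hf2 (vbar f)).comp_add_left (vbar f)
  have hmean : ∫ w, f (vbar f + w) * ⟪w, e⟫ = 0 := by
    rw [← integral_mul_inner_sub_eq_zero hfi hf1 hc e,
      ← integral_add_left_eq_self (fun v => f v * ⟪v - vbar f, e⟫) (vbar f)]
    simp only [add_sub_cancel_left]
  have hvar : ∫ w, f (vbar f + w) * ‖w‖ ^ 2 ≤ 2 * |E₀| := by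
    refine le_trans (le_of_eq ?_) ((integral_mul_norm_sub_sq_le h0 hfi hf1 hf2 hc).trans hE)
    rw [← integral_add_left_eq_self (fun v => f v * ‖v - vbar f‖ ^ 2) (vbar f)]
    simp only [add_sub_cancel_left]
  have hmain := mul_setIntegral_le_of_integral_inner_eq_zero hg0 hg he hshift1 hshift2 hmean η hr
  rw [← ofReal_integral_eq_lintegral_ofReal hg.integrableOn (.of_forall hg0)] at hlam ⊢
  have hlam' := (ENNReal.ofReal_le_ofReal_iff (integral_nonneg hg0)).1 hlam
  refine ENNReal.ofReal_le_ofReal ?_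
  have htail : r⁻¹ * ∫ w, f (vbar f + w) * ‖w‖ ^ 2 ≤ η * lam₁ / 2 := by
    rw [inv_mul_le_iff₀ hr]
    have : r * (η * lam₁) = 4 * |E₀| + η * lam₁ := by
      rw [hr_def]
      field_simp
    linarith
  have := mul_le_mul_of_nonneg_left hlam' hη.le
  rw [div_le_iff₀ (by positivity)]
  linarith
end
end

section
/- Let n ≥ 2, s ∈ (0,1), γ₀ > −n, γ ∈ (−n, γ₀], and q > 2. Assume f : ℝⁿ → [0,∞) is measurable and satisfies: the mass bound m₀ ≤ ∫_{ℝⁿ} f(v) dv ≤ M₀; the pressure lower bound inf_{σ ∈ S^{n-1}} sup_{e ∈ S^{n-1}, e ⊥ σ} ∫_{ℝⁿ} f(v̄ + w) |w·e|² dw ≥ p₀ > 0, where v̄ := (∫_{ℝⁿ} f(v) v dv)/(∫_{ℝⁿ} f(v) dv); and the moment bound ∫_{ℝⁿ} f(v) |v|^q dv ≤ M_q. Let K_f be the normalized Boltzmann-type kernel. Then there exists c > 0, depending only on n, m₀, M₀, p₀, M_q, q, γ₀ (independent of s), such that for every r > 0, every v ∈ ℝⁿ, and every e ∈ S^{n-1}: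 ∫_{B_r} K_f(v, v+h) · (max(h·e, 0))² dh ≥ c (1 + |v|)^{γ+2s−2} r^{2−2s}. -/
open MeasureTheory Metric Set
open scoped ENNReal RealInnerProductSpace NNReal

noncomputable section

/-- The normalized Boltzmann-type kernel
`K_f(v,v') = (1-s)|v'-v|^{-n-2s} ∫_{w ⊥ v'-v} f(v+w)|w|^{γ+2s+1} dw`,
with values in `[0,∞]`; the hyperplane integral is taken with respect to the
`(n-1)`-dimensional Hausdorff (i.e. Lebesgue) measure on the hyperplane through the origin
orthogonal to `v' - v`. -/
def KfE (n : ℕ) (s γ : ℝ) (f : En n → ℝ) (v v' : En n) : ℝ≥0∞ :=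
  ENNReal.ofReal ((1 - s) * ‖v' - v‖ ^ (-(n:ℝ) - 2*s)) *
    ∫⁻ w in {w : En n | ⟪w, v' - v⟫ = 0},
      ENNReal.ofReal (f (v + w) * ‖w‖ ^ (γ + 2*s + 1)) ∂μH[(n:ℝ) - 1]

theorem lintegral_comp_affine (H : ℝ → ℝ≥0∞) {c : ℝ} (hc : c ≠ 0) (d : ℝ) :
    ENNReal.ofReal |c| * ∫⁻ t, H (c * t + d) = ∫⁻ a, H a := by
  have h1 : ∫⁻ t, H (c * t + d) = ∫⁻ t, H (t + d) ∂(Measure.map (fun t : ℝ => c * t) volume) :=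
    (lintegral_map_equiv (μ := volume) (fun t => H (t + d))
      (Homeomorph.mulLeft₀ c hc).toMeasurableEquiv).symm
  rw [h1, Real.map_volume_mul_left hc, lintegral_smul_measure,
    lintegral_add_right_eq_self H d, smul_eq_mul, ← mul_assoc, ← ENNReal.ofReal_mul (abs_nonneg c),
    ← abs_mul, mul_inv_cancel₀ hc]
  simp

theorem lintegral_line_swap (Ψ : ℝ → ℝ → ℝ≥0∞) {p q : ℝ} (hp : p ≠ 0) (hq : q ≠ 0) (R : ℝ) :
    ∫⁻ t, ENNReal.ofReal (|q| / |p|) * Ψ (-(t * q + R) / p) t =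
      ∫⁻ a, Ψ a (-(a * p + R) / q) := by
  rw [← lintegral_comp_affine (fun a => Ψ a (-(a * p + R) / q)) (div_ne_zero hq hp |> neg_ne_zero.2)
    (-R / p), lintegral_const_mul' _ _ ENNReal.ofReal_ne_top, abs_neg, abs_div]
  congr 1
  refine lintegral_congr fun t => ?_
  congr 1
  · field_simp
    ring
  · field_simp
    ring

theorem lintegral_insertNth {m : ℕ} (k : Fin (m + 1)) {F : (Fin (m + 1) → ℝ) → ℝ≥0∞}
    (hF : Measurable F) :
    ∫⁻ h, F h = ∫⁻ y : Fin m → ℝ, ∫⁻ a : ℝ, F (k.insertNth a y) := by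
  have h := (volume_preserving_piFinSuccAbove (fun _ : Fin (m + 1) => ℝ) k).symm
  rw [← h.lintegral_comp hF, Measure.volume_eq_prod, lintegral_prod_symm _ (by fun_prop)]
  rfl

theorem measurable_insertNth {m : ℕ} (k : Fin (m + 1)) :
    Measurable fun p : ℝ × (Fin m → ℝ) => (k.insertNth p.1 p.2 : Fin (m + 1) → ℝ) :=
  (MeasurableEquiv.piFinSuccAbove (fun _ : Fin (m + 1) => ℝ) k).symm.measurable

theorem sum_insertNth_mul_insertNth {m : ℕ} {j k : Fin (m + 1)} (hjk : j ≠ k) (a t : ℝ)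
    (x y : Fin m → ℝ) :
    ∑ i, k.insertNth (α := fun _ => ℝ) a x i * j.insertNth (α := fun _ => ℝ) t y i =
      a * j.insertNth (α := fun _ => ℝ) 0 y k + t * k.insertNth (α := fun _ => ℝ) 0 x j +
      ∑ i, k.insertNth (α := fun _ => ℝ) 0 x i * j.insertNth (α := fun _ => ℝ) 0 y i := by
  have key : ∀ (l : Fin (m + 1)) (c : ℝ) (z : Fin m → ℝ) (i : Fin (m + 1)),
      l.insertNth (α := fun _ => ℝ) c z i =
        (if i = l then c else 0) + l.insertNth (α := fun _ => ℝ) 0 z i := by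
    intro l c z i
    rcases Fin.eq_self_or_eq_succAbove l i with rfl | ⟨i, rfl⟩ <;> simp [Fin.succAbove_ne]
  have e : ∀ i, k.insertNth (α := fun _ => ℝ) a x i * j.insertNth (α := fun _ => ℝ) t y i =
      (if i = k then a * j.insertNth (α := fun _ => ℝ) 0 y i else 0) +
      (if i = j then t * k.insertNth (α := fun _ => ℝ) 0 x i else 0) +
      k.insertNth (α := fun _ => ℝ) 0 x i * j.insertNth (α := fun _ => ℝ) 0 y i := by
    intro i
    rw [key k a, key j t]
    by_cases h1 : i = k
    · subst h1
      simp [hjk.symm]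
    · by_cases h2 : i = j
      · subst h2
        simp [h1, mul_comm]
      · simp [h1, h2]
  simp_rw [e, Finset.sum_add_distrib]
  simp

/-- The point of the hyperplane `h^⊥` whose coordinates other than the `j`-th are given by `y`. -/
def hyperplaneGraph {m : ℕ} (j : Fin (m + 1)) (h : Fin (m + 1) → ℝ) (y : Fin m → ℝ) :
    Fin (m + 1) → ℝ :=
  j.insertNth (-(∑ i, h (j.succAbove i) * y i) / h j) y

theorem measurable_hyperplaneGraph {m : ℕ} (j : Fin (m + 1)) :
    Measurable fun p : (Fin (m + 1) → ℝ) × (Fin m → ℝ) => hyperplaneGraph j p.1 p.2 := by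
  unfold hyperplaneGraph
  exact (measurable_insertNth j).comp (Measurable.prodMk (by fun_prop) measurable_snd)

theorem hyperplaneGraph_insertNth {m : ℕ} {j k : Fin (m + 1)} (hjk : j ≠ k) (a : ℝ)
    (x y : Fin m → ℝ) :
    hyperplaneGraph j (k.insertNth a x) y =
      j.insertNth (-(a * j.insertNth (α := fun _ => ℝ) 0 y k +
        ∑ i, k.insertNth (α := fun _ => ℝ) 0 x i * j.insertNth (α := fun _ => ℝ) 0 y i) /
          k.insertNth (α := fun _ => ℝ) 0 x j) y := by
  have h := sum_insertNth_mul_insertNth hjk a 0 x y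
  rw [Fin.sum_univ_succAbove _ j] at h
  simp only [Fin.insertNth_apply_same, mul_zero, zero_add, Fin.insertNth_apply_succAbove,
    zero_mul, add_zero] at h
  unfold hyperplaneGraph
  rw [h]
  congr 2
  obtain ⟨i, rfl⟩ := Fin.exists_succAbove_eq hjk
  simp

theorem lintegral_lintegral_insertNth {m : ℕ} (k : Fin (m + 1))
    {Φ : (Fin (m + 1) → ℝ) → (Fin m → ℝ) → ℝ≥0∞} (hΦ : Measurable (Function.uncurry Φ)) :
    ∫⁻ w, ∫⁻ x, Φ w x = ∫⁻ y, ∫⁻ x, ∫⁻ t, Φ (k.insertNth t y) x := by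
  rw [lintegral_insertNth k (Measurable.lintegral_prod_right hΦ)]
  refine lintegral_congr fun y => lintegral_lintegral_swap (Measurable.aemeasurable ?_)
  exact hΦ.comp (((measurable_insertNth k).comp
    (measurable_fst.prodMk measurable_const)).prodMk measurable_snd)

theorem measurable_lintegral_insertNth {m : ℕ} (k : Fin (m + 1))
    {Φ : (Fin (m + 1) → ℝ) → (Fin m → ℝ) → ℝ≥0∞} (hΦ : Measurable (Function.uncurry Φ)) :
    Measurable (Function.uncurry fun (y x : Fin m → ℝ) => ∫⁻ t, Φ (k.insertNth t y) x) := by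
  have h : Measurable fun p : ((Fin m → ℝ) × (Fin m → ℝ)) × ℝ =>
      Function.uncurry Φ (k.insertNth p.2 p.1.1, p.1.2) :=
    hΦ.comp (((measurable_insertNth k).comp
      (measurable_snd.prodMk (measurable_fst.comp measurable_fst))).prodMk
        (measurable_snd.comp measurable_fst))
  exact h.lintegral_prod_right'

theorem lintegral_hyperplaneGraph_swap {m : ℕ} {j k : Fin (m + 1)} (hjk : j ≠ k)
    {G : (Fin (m + 1) → ℝ) → (Fin (m + 1) → ℝ) → ℝ≥0∞} (hG : Measurable (Function.uncurry G)) :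
    ∫⁻ w, ∫⁻ x, ENNReal.ofReal (|hyperplaneGraph k w x j| / |w k|) *
        G (hyperplaneGraph k w x) w ≤
      ∫⁻ h, ∫⁻ y, G h (hyperplaneGraph j h y) := by
  have hmk := measurable_hyperplaneGraph k
  have hmj := measurable_hyperplaneGraph j
  have hGj : Measurable (Function.uncurry fun (h : Fin (m + 1) → ℝ) (y : Fin m → ℝ) =>
      G h (hyperplaneGraph j h y)) := hG.comp (measurable_fst.prodMk hmj)
  have hGk : Measurable (Function.uncurry fun (w : Fin (m + 1) → ℝ) (x : Fin m → ℝ) =>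
      ENNReal.ofReal (|hyperplaneGraph k w x j| / |w k|) * G (hyperplaneGraph k w x) w) := by
    refine Measurable.mul ?_ (hG.comp (hmk.prodMk measurable_fst))
    refine ENNReal.measurable_ofReal.comp (Measurable.div ?_ ?_)
    · exact ((measurable_pi_apply j).comp hmk).abs
    · exact ((measurable_pi_apply k).comp measurable_fst).abs
  rw [lintegral_lintegral_insertNth j hGk, lintegral_lintegral_insertNth k hGj,
    lintegral_lintegral_swap (measurable_lintegral_insertNth j hGk).aemeasurable]
  refine lintegral_mono fun x => lintegral_mono fun y => ?_
  set p := j.insertNth (α := fun _ => ℝ) 0 y k with hp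
  set q := k.insertNth (α := fun _ => ℝ) 0 x j with hq
  have hp' : ∀ t, j.insertNth (α := fun _ => ℝ) t y k = p := by
    obtain ⟨i, rfl⟩ := Fin.exists_succAbove_eq hjk.symm
    simp [hp]
  have hq' : ∀ t, k.insertNth (α := fun _ => ℝ) t x j = q := by
    obtain ⟨i, rfl⟩ := Fin.exists_succAbove_eq hjk
    simp [hq]
  have hgj : ∀ z, hyperplaneGraph k z x j = q := fun z => hq' _
  simp only [hgj, hp']
  by_cases hp0 : p = 0
  · simp [hp0]
  by_cases hq0 : q = 0
  · simp [hq0]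
  have h2 := lintegral_line_swap (fun a t => G (k.insertNth a x) (j.insertNth t y)) hp0 hq0
    (∑ i, k.insertNth (α := fun _ => ℝ) 0 x i * j.insertNth (α := fun _ => ℝ) 0 y i)
  refine (le_of_eq ?_).trans (h2.le.trans (le_of_eq ?_))
  · refine lintegral_congr fun t => ?_
    rw [hyperplaneGraph_insertNth hjk.symm]
    simp only [mul_comm]
    rfl
  · refine lintegral_congr fun a => ?_
    rw [hyperplaneGraph_insertNth hjk]

theorem real_inner_eq_sum {n : ℕ} (x y : En n) : ⟪x, y⟫ = ∑ i, x i * y i := by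
  simp [PiLp.inner_apply, mul_comm]

theorem eq_hyperplaneGraph {m : ℕ} (j : Fin (m + 1)) {h w : En (m + 1)} (hj : h j ≠ 0)
    (hw : ⟪w, h⟫ = 0) :
    WithLp.toLp 2 (hyperplaneGraph j h.ofLp fun i => w (j.succAbove i)) = w := by
  rw [real_inner_eq_sum, Fin.sum_univ_succAbove _ j] at hw
  ext i
  rcases Fin.eq_self_or_eq_succAbove j i with rfl | ⟨i, rfl⟩
  · simp only [hyperplaneGraph, Fin.insertNth_apply_same]
    rw [div_eq_iff hj]
    simp only [mul_comm (h.ofLp _)]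
    linarith
  · simp [hyperplaneGraph]

theorem inner_hyperplaneGraph {m : ℕ} (j : Fin (m + 1)) {h : En (m + 1)} (hj : h j ≠ 0)
    (y : Fin m → ℝ) : ⟪WithLp.toLp 2 (hyperplaneGraph j h.ofLp y), h⟫ = 0 := by
  rw [real_inner_eq_sum, Fin.sum_univ_succAbove _ j]
  simp only [hyperplaneGraph, Fin.insertNth_apply_same, Fin.insertNth_apply_succAbove]
  rw [div_mul_cancel₀ _ hj]
  simp [mul_comm]

theorem lintegral_hyperplaneGraph_le {m : ℕ} (j : Fin (m + 1)) {h : En (m + 1)} (hj : h j ≠ 0)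
    {F : En (m + 1) → ℝ≥0∞} (hF : Measurable F) :
    ∫⁻ y, F (WithLp.toLp 2 (hyperplaneGraph j h.ofLp y)) ≤
      ∫⁻ w in {w : En (m + 1) | ⟪w, h⟫ = 0}, F w ∂μH[((m + 1 : ℕ) : ℝ) - 1] := by
  set S := {w : En (m + 1) | ⟪w, h⟫ = 0} with hS
  have hSm : MeasurableSet S := measurableSet_eq_fun (by fun_prop) measurable_const
  set pr : En (m + 1) → Fin m → ℝ := fun w i => w (j.succAbove i) with hpr
  have hprm : Measurable pr := by fun_prop
  have hlip : LipschitzWith 1 pr := by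
    refine LipschitzWith.of_dist_le_mul fun x y => ?_
    rw [NNReal.coe_one, one_mul, dist_eq_norm, dist_eq_norm, pi_norm_le_iff_of_nonneg (norm_nonneg _)]
    exact fun i => PiLp.norm_apply_le (x - y) (j.succAbove i)
  set Φ : (Fin m → ℝ) → ℝ≥0∞ := fun y => F (WithLp.toLp 2 (hyperplaneGraph j h.ofLp y)) with hΦ
  have hΦm : Measurable Φ := by
    refine hF.comp ((WithLp.measurable_toLp 2 _).comp ?_)
    exact (measurable_hyperplaneGraph j).comp (measurable_const.prodMk measurable_id)
  have hcard : ((m + 1 : ℕ) : ℝ) - 1 = (Fintype.card (Fin m) : ℝ) := by simp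
  rw [hcard]
  have h1 : ∫⁻ w in S, F w ∂μH[(Fintype.card (Fin m) : ℝ)] =
      ∫⁻ w in S, Φ (pr w) ∂μH[(Fintype.card (Fin m) : ℝ)] := by
    refine setLIntegral_congr_fun hSm fun w hw => ?_
    simp only [hΦ, hpr]
    rw [eq_hyperplaneGraph j hj hw]
  rw [h1, ← lintegral_map hΦm hprm]
  refine lintegral_mono' (Measure.le_iff.2 fun B hB => ?_) le_rfl
  rw [Measure.map_apply hprm hB, Measure.restrict_apply (hprm hB), ← hausdorffMeasure_pi_real]
  have hsub : B ⊆ pr '' (pr ⁻¹' B ∩ S) := by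
    intro y hy
    have hpy : pr (WithLp.toLp 2 (hyperplaneGraph j h.ofLp y)) = y := by
      ext i
      simp [hpr, hyperplaneGraph]
    exact ⟨_, ⟨by rwa [mem_preimage, hpy], inner_hyperplaneGraph j hj y⟩, hpy⟩
  refine (measure_mono hsub).trans ((hlip.hausdorffMeasure_image_le (by positivity) _).trans ?_)
  simp

/-- Integrals of `(y·u)₊²` against a radial weight depend on `u` only through its norm. -/
theorem lintegral_radial_mul_pos_sq_eq {m : ℕ} (φ : ℝ → ℝ≥0∞)
    {u u' : En m} (huu : ‖u‖ = ‖u'‖) :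
    ∫⁻ y : En m, φ ‖y‖ * ENNReal.ofReal (max ⟪y, u⟫ 0 ^ 2) =
      ∫⁻ y : En m, φ ‖y‖ * ENNReal.ofReal (max ⟪y, u'⟫ 0 ^ 2) := by
  set T := Submodule.reflection (Submodule.orthogonal (Submodule.span ℝ {u - u'})) with hT
  have hTu : T u = u' := Submodule.reflection_sub huu
  rw [← (T.measurePreserving).lintegral_comp_emb T.toHomeomorph.measurableEmbedding
    (fun y => φ ‖y‖ * ENNReal.ofReal (max ⟪y, u'⟫ 0 ^ 2))]
  refine lintegral_congr fun y => ?_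
  rw [← hTu, T.norm_map, T.inner_map_map]

theorem lintegral_radial_mul_pos_sq {m : ℕ} {φ : ℝ → ℝ≥0∞} (hφ : Measurable φ) (u : En m) :
    ENNReal.ofReal (‖u‖ ^ 2) * ∫⁻ y : En m, φ ‖y‖ * ENNReal.ofReal (‖y‖ ^ 2) =
      2 * m * ∫⁻ y : En m, φ ‖y‖ * ENNReal.ofReal (max ⟪y, u⟫ 0 ^ 2) := by
  have hpt : ∀ y : En m, ENNReal.ofReal (‖u‖ ^ 2) * (φ ‖y‖ * ENNReal.ofReal (‖y‖ ^ 2)) =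
      ∑ i : Fin m, (φ ‖y‖ * ENNReal.ofReal (max ⟪y, EuclideanSpace.single i ‖u‖⟫ 0 ^ 2) +
        φ ‖y‖ * ENNReal.ofReal (max ⟪y, EuclideanSpace.single i (-‖u‖)⟫ 0 ^ 2)) := by
    intro y
    have hi : ∀ i : Fin m, ENNReal.ofReal (max ⟪y, EuclideanSpace.single i ‖u‖⟫ 0 ^ 2) +
        ENNReal.ofReal (max ⟪y, EuclideanSpace.single i (-‖u‖)⟫ 0 ^ 2) =
        ENNReal.ofReal (‖u‖ ^ 2 * y i ^ 2) := by
      intro i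
      rw [← ENNReal.ofReal_add (by positivity) (by positivity)]
      congr 1
      simp only [EuclideanSpace.inner_single_right, conj_trivial]
      rcases le_total 0 (‖u‖ * y i) with h | h
      · rw [max_eq_left h, max_eq_right (by linarith)]
        ring
      · rw [max_eq_right h, max_eq_left (by linarith)]
        ring
    simp_rw [← mul_add, hi, ← Finset.mul_sum]
    rw [← ENNReal.ofReal_sum_of_nonneg (fun i _ => by positivity), ← Finset.mul_sum,
      ← EuclideanSpace.real_norm_sq_eq, ENNReal.ofReal_mul (by positivity)]
    ring
  rw [← lintegral_const_mul' _ _ ENNReal.ofReal_ne_top]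
  simp_rw [hpt]
  have hm : ∀ v : En m, Measurable fun y : En m =>
      φ ‖y‖ * ENNReal.ofReal (max ⟪y, v⟫ 0 ^ 2) := fun v => by fun_prop
  rw [lintegral_finsetSum (f := fun (i : Fin m) (y : En m) =>
    φ ‖y‖ * ENNReal.ofReal (max ⟪y, EuclideanSpace.single i ‖u‖⟫ 0 ^ 2) +
      φ ‖y‖ * ENNReal.ofReal (max ⟪y, EuclideanSpace.single i (-‖u‖)⟫ 0 ^ 2)) _
    (fun i _ => (hm _).add (hm _))]
  have hc : ∀ i : Fin m, ∫⁻ y : En m,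
      (φ ‖y‖ * ENNReal.ofReal (max ⟪y, EuclideanSpace.single i ‖u‖⟫ 0 ^ 2) +
        φ ‖y‖ * ENNReal.ofReal (max ⟪y, EuclideanSpace.single i (-‖u‖)⟫ 0 ^ 2)) =
      2 * ∫⁻ y : En m, φ ‖y‖ * ENNReal.ofReal (max ⟪y, u⟫ 0 ^ 2) := by
    intro i
    rw [lintegral_add_left (hm _),
      lintegral_radial_mul_pos_sq_eq φ (u := EuclideanSpace.single i ‖u‖) (u' := u) (by simp),
      lintegral_radial_mul_pos_sq_eq φ (u := EuclideanSpace.single i (-‖u‖)) (u' := u) (by simp),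
      two_mul]
  simp_rw [hc]
  simp
  ring

theorem lintegral_ball_norm_rpow {m : ℕ} (hm : 1 ≤ m) {s ρ : ℝ} (hs : s < 1) (hρ : 0 < ρ) :
    ENNReal.ofReal (m * (volume.real (ball (0 : En m) 1) * (ρ ^ (2 - 2 * s) / (2 - 2 * s)))) ≤
      ∫⁻ y : En m, ENNReal.ofReal ((Iio ρ).indicator (fun t => t ^ (-(m : ℝ) - 2 * s)) ‖y‖) *
        ENNReal.ofReal (‖y‖ ^ 2) := by
  have : Nontrivial (En m) := by
    have : Nonempty (Fin m) := ⟨⟨0, hm⟩⟩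
    infer_instance
  have h := integral_fun_norm_addHaar (volume : Measure (En m))
    ((Iio ρ).indicator (fun t : ℝ => t ^ (-(m : ℝ) - 2 * s) * t ^ 2))
  have h1 : ∫ y in Ioi (0 : ℝ), y ^ (Module.finrank ℝ (En m) - 1) •
      (Iio ρ).indicator (fun t : ℝ => t ^ (-(m : ℝ) - 2 * s) * t ^ 2) y =
      ρ ^ (2 - 2 * s) / (2 - 2 * s) := by
    have e : ∀ y ∈ Ioi (0 : ℝ), y ^ (Module.finrank ℝ (En m) - 1) •
        (Iio ρ).indicator (fun t : ℝ => t ^ (-(m : ℝ) - 2 * s) * t ^ 2) y =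
        (Iio ρ).indicator (fun t : ℝ => t ^ (1 - 2 * s)) y := by
      intro y hy
      by_cases hyρ : y < ρ
      · rw [indicator_of_mem (mem_Iio.2 hyρ), indicator_of_mem (mem_Iio.2 hyρ), smul_eq_mul,
          ← Real.rpow_natCast, ← Real.rpow_natCast, ← Real.rpow_add hy, ← Real.rpow_add hy]
        congr 1
        rw [finrank_euclideanSpace_fin, Nat.cast_sub hm]
        push_cast
        ring
      · simp [hyρ]
    rw [setIntegral_congr_fun measurableSet_Ioi e, setIntegral_indicator measurableSet_Iio,
      Ioi_inter_Iio, ← integral_Ioc_eq_integral_Ioo, ← intervalIntegral.integral_of_le hρ.le,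
      integral_rpow (Or.inl (by linarith)), Real.zero_rpow (by linarith)]
    congr 1 <;> ring_nf
  rw [h1, finrank_euclideanSpace_fin, nsmul_eq_mul, smul_eq_mul] at h
  rw [← h, integral_eq_lintegral_of_nonneg_ae]
  · refine ENNReal.ofReal_toReal_le.trans (lintegral_mono fun y => ?_)
    rw [← ENNReal.ofReal_mul' (by positivity)]
    refine le_of_eq (congrArg _ ?_)
    by_cases hy : ‖y‖ < ρ <;> simp [indicator, hy]
  · refine Filter.Eventually.of_forall fun y => ?_
    simp only [indicator, Pi.zero_apply]
    split_ifs <;> positivity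
  · refine Measurable.aestronglyMeasurable ?_
    exact (Measurable.indicator (by fun_prop) measurableSet_Iio).comp measurable_norm

theorem exists_lintegral_ball_pos_sq_ge {m : ℕ} (hm : 1 ≤ m) :
    ∃ κ : ℝ, 0 < κ ∧ ∀ s ρ : ℝ, s < 1 → 0 < ρ → ∀ u : En m,
      ENNReal.ofReal (κ * ‖u‖ ^ 2 * ρ ^ (2 - 2 * s)) ≤
        ENNReal.ofReal (1 - s) * ∫⁻ y : En m,
          ENNReal.ofReal ((Iio ρ).indicator (fun t => t ^ (-(m : ℝ) - 2 * s)) ‖y‖) *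
            ENNReal.ofReal (max ⟪y, u⟫ 0 ^ 2) := by
  set V := volume.real (ball (0 : En m) 1) with hV
  have hVpos : 0 < V := ENNReal.toReal_pos (measure_ball_pos _ _ one_pos).ne' measure_ball_lt_top.ne
  have hm0 : (0 : ℝ) < m := by exact_mod_cast hm
  refine ⟨V / 4, by positivity, fun s ρ hs hρ u => ?_⟩
  have h1 := lintegral_ball_norm_rpow hm hs hρ
  have h2 := lintegral_radial_mul_pos_sq
    (φ := fun r => ENNReal.ofReal ((Iio ρ).indicator (fun t => t ^ (-(m : ℝ) - 2 * s)) r))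
    (ENNReal.measurable_ofReal.comp (Measurable.indicator (by fun_prop) measurableSet_Iio)) u
  set Q := ∫⁻ y : En m, ENNReal.ofReal ((Iio ρ).indicator (fun t => t ^ (-(m : ℝ) - 2 * s)) ‖y‖) *
            ENNReal.ofReal (max ⟪y, u⟫ 0 ^ 2)
  have h3 := mul_le_mul_right h1 (ENNReal.ofReal (‖u‖ ^ 2))
  rw [h2, ← ENNReal.ofReal_mul (by positivity)] at h3
  have h4 := mul_le_mul_right h3 (ENNReal.ofReal ((1 - s) / (2 * m)))
  rw [← ENNReal.ofReal_mul (div_nonneg (by linarith) (by positivity))] at h4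
  refine (le_of_eq ?_).trans (h4.trans (le_of_eq ?_))
  · congr 1
    have : 1 - s ≠ 0 := by linarith
    have h5 : 2 - 2 * s = 2 * (1 - s) := by ring
    rw [h5]
    field_simp
    ring
  · rw [← mul_assoc]
    congr 1
    rw [← ENNReal.ofReal_natCast m, ← ENNReal.ofReal_ofNat 2, ← ENNReal.ofReal_mul (by norm_num),
      ← ENNReal.ofReal_mul (div_nonneg (by linarith) (by positivity))]
    congr 1
    field_simp

theorem norm_le_norm_hyperplaneGraph {m : ℕ} (k : Fin (m + 1)) (w : Fin (m + 1) → ℝ)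
    (x : Fin m → ℝ) :
    ‖(WithLp.toLp 2 x : En m)‖ ≤ ‖(WithLp.toLp 2 (hyperplaneGraph k w x) : En (m + 1))‖ := by
  rw [EuclideanSpace.norm_eq, EuclideanSpace.norm_eq, Fin.sum_univ_succAbove _ k]
  refine Real.sqrt_le_sqrt ?_
  simp only [hyperplaneGraph, Fin.insertNth_apply_succAbove]
  exact le_add_of_nonneg_left (by positivity)

theorem norm_hyperplaneGraph_le {m : ℕ} {k : Fin (m + 1)} {w : Fin (m + 1) → ℝ}
    (hk : ∀ i, |w i| ≤ |w k|) (x : Fin m → ℝ) :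
    ‖(WithLp.toLp 2 (hyperplaneGraph k w x) : En (m + 1))‖ ≤
      (m + 1) * ‖(WithLp.toLp 2 x : En m)‖ := by
  set X : En m := WithLp.toLp 2 x with hX
  have hx : ∀ i, |x i| ≤ ‖X‖ := fun i => PiLp.norm_apply_le X i
  have h0 : |hyperplaneGraph k w x k| ≤ m * ‖X‖ := by
    simp only [hyperplaneGraph, Fin.insertNth_apply_same, abs_div, abs_neg]
    refine div_le_of_le_mul₀ (abs_nonneg _) (by positivity) ?_
    calc |∑ i, w (k.succAbove i) * x i| ≤ ∑ i, |w (k.succAbove i) * x i| :=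
          Finset.abs_sum_le_sum_abs _ _
      _ ≤ ∑ _i : Fin m, |w k| * ‖X‖ := by
          refine Finset.sum_le_sum fun i _ => ?_
          rw [abs_mul]
          exact mul_le_mul (hk _) (hx i) (abs_nonneg _) (abs_nonneg _)
      _ = m * ‖X‖ * |w k| := by
          simp
          ring
  refine (sq_le_sq₀ (norm_nonneg _) (by positivity)).1 ?_
  rw [EuclideanSpace.real_norm_sq_eq, Fin.sum_univ_succAbove _ k]
  have h1 : ∑ i : Fin m, hyperplaneGraph k w x (k.succAbove i) ^ 2 = ‖X‖ ^ 2 := by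
    rw [EuclideanSpace.real_norm_sq_eq]
    simp [hyperplaneGraph, hX]
  have h2 : hyperplaneGraph k w x k ^ 2 ≤ (m * ‖X‖) ^ 2 := by
    rw [← sq_abs]
    gcongr
  simp only [h1]
  nlinarith [sq_nonneg ‖X‖, mul_nonneg (Nat.cast_nonneg (α := ℝ) m) (sq_nonneg ‖X‖)]

/-- The coordinates of the linear form `⟪·, e⟫` restricted to `w^⊥`, in the graph coordinates. -/
def graphDual {m : ℕ} (k : Fin (m + 1)) (w e : En (m + 1)) : En m :=
  WithLp.toLp 2 fun i => e (k.succAbove i) - e k / w k * w (k.succAbove i)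

theorem inner_hyperplaneGraph_eq {m : ℕ} (k : Fin (m + 1)) (w e : En (m + 1)) (x : Fin m → ℝ) :
    ⟪(WithLp.toLp 2 (hyperplaneGraph k w.ofLp x) : En (m + 1)), e⟫ =
      ⟪(WithLp.toLp 2 x : En m), graphDual k w e⟫ := by
  rw [real_inner_eq_sum, real_inner_eq_sum, Fin.sum_univ_succAbove _ k]
  simp only [hyperplaneGraph, Fin.insertNth_apply_same, Fin.insertNth_apply_succAbove, graphDual,
    mul_sub, Finset.sum_sub_distrib]
  have : -(∑ i, w.ofLp (k.succAbove i) * x i) / w.ofLp k * e.ofLp k =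
      -∑ i, x i * (e.ofLp k / w.ofLp k * w.ofLp (k.succAbove i)) := by
    rw [neg_div, neg_mul, Finset.sum_div, Finset.sum_mul]
    congr 1
    exact Finset.sum_congr rfl fun i _ => by ring
  rw [this]
  ring

theorem sq_inner_le_of_orthonormal_pair {n : ℕ} {e e' : En n} (he : ‖e‖ = 1) (he' : ‖e'‖ = 1)
    (hee : ⟪e', e⟫ = 0) (w : En n) : ⟪w, e⟫ ^ 2 + ⟪w, e'⟫ ^ 2 ≤ ‖w‖ ^ 2 := by
  have h : 0 ≤ ⟪w - ⟪w, e⟫ • e - ⟪w, e'⟫ • e', w - ⟪w, e⟫ • e - ⟪w, e'⟫ • e'⟫ :=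
    real_inner_self_nonneg
  have hee2 : ⟪e, e'⟫ = 0 := by rw [real_inner_comm, hee]
  have h1 : ⟪e, e⟫ = 1 := by rw [real_inner_self_eq_norm_sq, he, one_pow]
  have h2 : ⟪e', e'⟫ = 1 := by rw [real_inner_self_eq_norm_sq, he', one_pow]
  simp only [inner_sub_left, inner_sub_right, real_inner_smul_left, real_inner_smul_right,
    h1, h2, hee, hee2, real_inner_comm w e, real_inner_comm w e'] at h
  rw [← real_inner_self_eq_norm_sq]
  nlinarith

theorem sq_inner_le_norm_graphDual {m : ℕ} {k : Fin (m + 1)} {w e e' : En (m + 1)}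
    (hk : w k ≠ 0) (he : ‖e‖ = 1) (he' : ‖e'‖ = 1) (hee : ⟪e', e⟫ = 0) :
    ⟪w, e'⟫ ^ 2 ≤ ‖w‖ ^ 2 * ‖graphDual k w e‖ ^ 2 := by
  set l := e k / w k with hl
  have h1 : ‖graphDual k w e‖ ^ 2 = ‖e - l • w‖ ^ 2 := by
    rw [EuclideanSpace.real_norm_sq_eq, EuclideanSpace.real_norm_sq_eq, Fin.sum_univ_succAbove _ k]
    simp [graphDual, ← hl]
    rw [hl, div_mul_cancel₀ _ hk]
    ring
  have h2 : ‖e - l • w‖ ^ 2 = 1 - 2 * l * ⟪w, e⟫ + l ^ 2 * ‖w‖ ^ 2 := by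
    rw [norm_sub_sq_real, he, real_inner_smul_right, norm_smul, mul_pow, Real.norm_eq_abs, sq_abs,
      real_inner_comm]
    ring
  have h3 := sq_inner_le_of_orthonormal_pair he he' hee w
  rw [h1, h2]
  nlinarith [sq_nonneg (l * ‖w‖ ^ 2 - ⟪w, e⟫)]

theorem norm_le_sum_abs {m : ℕ} (x : Fin m → ℝ) :
    ‖(WithLp.toLp 2 x : En m)‖ ≤ ∑ i, |x i| := by
  refine (sq_le_sq₀ (norm_nonneg _) (Finset.sum_nonneg fun i _ => abs_nonneg _)).1 ?_
  rw [EuclideanSpace.real_norm_sq_eq]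
  refine le_trans (le_of_eq ?_) (Finset.sum_sq_le_sq_sum_of_nonneg (fun i _ => abs_nonneg (x i)))
  simp

/-- The weight `(1-s)|h|^{-n-2s} (h·e)₊²` on the ball `B_r`. -/
def kernelWeight {n : ℕ} (s r : ℝ) (e h : En n) : ℝ≥0∞ :=
  (ball (0 : En n) r).indicator (fun h => ENNReal.ofReal ((1 - s) * ‖h‖ ^ (-(n : ℝ) - 2 * s)) *
    ENNReal.ofReal (max ⟪h, e⟫ 0 ^ 2)) h

theorem measurable_kernelWeight {n : ℕ} (s r : ℝ) (e : En n) :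
    Measurable (kernelWeight s r e) :=
  Measurable.indicator (by fun_prop) measurableSet_ball

theorem le_kernelWeight_hyperplaneGraph {m : ℕ} {s r : ℝ} (hs : s ∈ Ioo (0 : ℝ) 1)
    {k : Fin (m + 1)} {w e : En (m + 1)} (hwk : w k ≠ 0) (hk : ∀ i, |w i| ≤ |w k|)
    (x : Fin m → ℝ) :
    ENNReal.ofReal (((m : ℝ) + 1) ^ (-(m : ℝ) - 3) / ‖w‖) * (ENNReal.ofReal (1 - s) *
        (ENNReal.ofReal ((Iio (r / (m + 1))).indicator (fun t => t ^ (-(m : ℝ) - 2 * s))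
          ‖(WithLp.toLp 2 x : En m)‖) *
            ENNReal.ofReal (max ⟪(WithLp.toLp 2 x : En m), graphDual k w e⟫ 0 ^ 2))) ≤
      ENNReal.ofReal ((∑ i, |x i|) / |w k|) *
        kernelWeight s r e (WithLp.toLp 2 (hyperplaneGraph k w.ofLp x)) := by
  obtain ⟨hs0, hs1⟩ := hs
  set X : En m := WithLp.toLp 2 x with hX
  set H : En (m + 1) := WithLp.toLp 2 (hyperplaneGraph k w.ofLp x) with hH
  have hw : |w k| ≤ ‖w‖ := PiLp.norm_apply_le w k
  have hwk' : 0 < |w k| := abs_pos.2 hwk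
  have hN : (0 : ℝ) < m + 1 := by positivity
  have hXH : ‖X‖ ≤ ‖H‖ := norm_le_norm_hyperplaneGraph k w.ofLp x
  have hHX : ‖H‖ ≤ (m + 1) * ‖X‖ := norm_hyperplaneGraph_le hk x
  by_cases hX0 : X = 0
  · simp [hX0]
  have hXpos : 0 < ‖X‖ := norm_pos_iff.2 hX0
  by_cases hXr : ‖X‖ < r / (m + 1)
  swap
  · simp [indicator, hXr]
  have hHr : H ∈ ball (0 : En (m + 1)) r := by
    rw [mem_ball_zero_iff]
    exact hHX.trans_lt (by rwa [lt_div_iff₀' hN] at hXr)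
  rw [kernelWeight, indicator_of_mem hHr, indicator_of_mem (mem_Iio.2 hXr),
    inner_hyperplaneGraph_eq, ← mul_assoc, ← mul_assoc, ← mul_assoc]
  gcongr ?_ * _
  rw [← ENNReal.ofReal_mul (by positivity), ← ENNReal.ofReal_mul (mul_nonneg (by positivity) (by linarith)),
    ← ENNReal.ofReal_mul (by positivity)]
  refine ENNReal.ofReal_le_ofReal ?_
  have h1 : ((m : ℝ) + 1) ^ (-(m : ℝ) - 3) * ‖X‖ ^ (-(m : ℝ) - 2 * s) ≤
      ‖X‖ * ‖H‖ ^ (-((m + 1 : ℕ) : ℝ) - 2 * s) := by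
    calc ((m : ℝ) + 1) ^ (-(m : ℝ) - 3) * ‖X‖ ^ (-(m : ℝ) - 2 * s)
        ≤ ((m : ℝ) + 1) ^ (-((m + 1 : ℕ) : ℝ) - 2 * s) * ‖X‖ ^ (-(m : ℝ) - 2 * s) := by
          gcongr ?_ * _
          refine Real.rpow_le_rpow_of_exponent_le ?_ ?_
          · linarith [(Nat.cast_nonneg m : (0 : ℝ) ≤ m)]
          · push_cast
            linarith
      _ = ‖X‖ * ((m + 1) * ‖X‖) ^ (-((m + 1 : ℕ) : ℝ) - 2 * s) := by
          rw [Real.mul_rpow hN.le hXpos.le]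
          have : -(m : ℝ) - 2 * s = 1 + (-((m + 1 : ℕ) : ℝ) - 2 * s) := by
            push_cast
            ring
          rw [this, Real.rpow_add hXpos, Real.rpow_one]
          ring
      _ ≤ ‖X‖ * ‖H‖ ^ (-((m + 1 : ℕ) : ℝ) - 2 * s) := by
          gcongr ?_ * ?_
          exact Real.rpow_le_rpow_of_nonpos (hXpos.trans_le hXH) hHX (by push_cast; linarith)
  have h2 : ‖X‖ / ‖w‖ ≤ (∑ i, |x i|) / |w k| := by
    have := norm_le_sum_abs x
    gcongr
  have h3 : 0 ≤ 1 - s := by linarith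
  calc ((m : ℝ) + 1) ^ (-(m : ℝ) - 3) / ‖w‖ * (1 - s) * ‖X‖ ^ (-(m : ℝ) - 2 * s)
      = ((m : ℝ) + 1) ^ (-(m : ℝ) - 3) * ‖X‖ ^ (-(m : ℝ) - 2 * s) * ((1 - s) / ‖w‖) := by ring
    _ ≤ ‖X‖ * ‖H‖ ^ (-((m + 1 : ℕ) : ℝ) - 2 * s) * ((1 - s) / ‖w‖) := by gcongr
    _ = ‖X‖ / ‖w‖ * ((1 - s) * ‖H‖ ^ (-((m + 1 : ℕ) : ℝ) - 2 * s)) := by ring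
    _ ≤ _ := by gcongr

theorem exists_lintegral_kernelWeight_ge {m : ℕ} (hm : 1 ≤ m) :
    ∃ c : ℝ, 0 < c ∧ ∀ s r : ℝ, s ∈ Ioo (0 : ℝ) 1 → 0 < r → ∀ e e' : En (m + 1), ‖e‖ = 1 →
      ‖e'‖ = 1 → ⟪e', e⟫ = 0 → ∀ (k : Fin (m + 1)) (w : En (m + 1)), w k ≠ 0 →
      (∀ i, |w i| ≤ |w k|) →
      ENNReal.ofReal (c * r ^ (2 - 2 * s) * (⟪w, e'⟫ ^ 2 / ‖w‖ ^ 3)) ≤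
        ∫⁻ x : Fin m → ℝ, ENNReal.ofReal ((∑ i, |x i|) / |w k|) *
          kernelWeight s r e (WithLp.toLp 2 (hyperplaneGraph k w.ofLp x)) := by
  obtain ⟨κ, hκ, hκ'⟩ := exists_lintegral_ball_pos_sq_ge hm
  have hN : (0 : ℝ) < m + 1 := by positivity
  refine ⟨((m : ℝ) + 1) ^ (-(m : ℝ) - 3) * κ * ((m : ℝ) + 1) ^ (-2 : ℝ), by positivity, ?_⟩
  intro s r hs hr e e' he he' hee k w hwk hk
  refine le_trans ?_ (lintegral_mono fun x => le_kernelWeight_hyperplaneGraph hs hwk hk x)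
  rw [lintegral_const_mul' _ _ ENNReal.ofReal_ne_top, lintegral_const_mul' _ _ ENNReal.ofReal_ne_top,
    (PiLp.volume_preserving_toLp (Fin m)).lintegral_comp_emb
      (MeasurableEquiv.toLp 2 (Fin m → ℝ)).measurableEmbedding (fun X : En m =>
        ENNReal.ofReal ((Iio (r / (m + 1))).indicator (fun t => t ^ (-(m : ℝ) - 2 * s)) ‖X‖) *
          ENNReal.ofReal (max ⟪X, graphDual k w e⟫ 0 ^ 2))]
  refine le_trans ?_ (mul_le_mul_right (hκ' s (r / (m + 1)) hs.2 (by positivity) _) _)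
  rw [← ENNReal.ofReal_mul (by positivity)]
  refine ENNReal.ofReal_le_ofReal ?_
  have hw0 : 0 < ‖w‖ := (abs_pos.2 hwk).trans_le (PiLp.norm_apply_le w k)
  have h1 := sq_inner_le_norm_graphDual hwk he he' hee
  have h2 : ⟪w, e'⟫ ^ 2 / ‖w‖ ^ 3 ≤ ‖graphDual k w e‖ ^ 2 / ‖w‖ := by
    rw [div_le_div_iff₀ (by positivity) hw0]
    nlinarith
  have h3 : ((m : ℝ) + 1) ^ (-2 : ℝ) * r ^ (2 - 2 * s) ≤ (r / (m + 1)) ^ (2 - 2 * s) := by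
    rw [Real.div_rpow hr.le hN.le, div_eq_mul_inv, ← Real.rpow_neg hN.le, mul_comm]
    gcongr
    · linarith [(Nat.cast_nonneg m : (0 : ℝ) ≤ m)]
    · linarith [hs.1]
  calc _ = ((m : ℝ) + 1) ^ (-(m : ℝ) - 3) * κ * (((m : ℝ) + 1) ^ (-2 : ℝ) * r ^ (2 - 2 * s)) *
        (⟪w, e'⟫ ^ 2 / ‖w‖ ^ 3) := by ring
    _ ≤ ((m : ℝ) + 1) ^ (-(m : ℝ) - 3) * κ * ((r / (m + 1)) ^ (2 - 2 * s)) *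
        (‖graphDual k w e‖ ^ 2 / ‖w‖) := by gcongr
    _ = _ := by ring

theorem measurable_coord_div_mul_hyperplaneGraph {m : ℕ}
    {G : (Fin (m + 1) → ℝ) → (Fin (m + 1) → ℝ) → ℝ≥0∞} (hG : Measurable (Function.uncurry G))
    (k : Fin (m + 1)) (i : Fin m) :
    Measurable (Function.uncurry fun (w : Fin (m + 1) → ℝ) (x : Fin m → ℝ) =>
      ENNReal.ofReal (|x i| / |w k|) * G (hyperplaneGraph k w x) w) := by
  have h1 : Measurable fun p : (Fin (m + 1) → ℝ) × (Fin m → ℝ) =>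
      ENNReal.ofReal (|p.2 i| / |p.1 k|) := by fun_prop
  exact h1.mul (hG.comp ((measurable_hyperplaneGraph k).prodMk measurable_fst))

theorem exists_lintegral_kernelWeight_hyperplane_ge {m : ℕ} (hm : 1 ≤ m) :
    ∃ c : ℝ, 0 < c ∧ ∀ s r : ℝ, s ∈ Ioo (0 : ℝ) 1 → 0 < r → ∀ e e' : En (m + 1), ‖e‖ = 1 →
      ‖e'‖ = 1 → ⟪e', e⟫ = 0 → ∀ F : En (m + 1) → ℝ≥0∞, Measurable F →
      ∫⁻ w, F w * ENNReal.ofReal (c * r ^ (2 - 2 * s) * (⟪w, e'⟫ ^ 2 / ‖w‖ ^ 3)) ≤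
        ∫⁻ h, kernelWeight s r e h *
          ∫⁻ w in {w : En (m + 1) | ⟪w, h⟫ = 0}, F w ∂μH[((m + 1 : ℕ) : ℝ) - 1] := by
  obtain ⟨c, hc, hc'⟩ := exists_lintegral_kernelWeight_ge hm
  set N : ℕ := (m + 1) * m with hN
  have hN0 : (0 : ℝ) < N := by
    have : 0 < N := by positivity
    exact_mod_cast this
  refine ⟨c / N, by positivity, ?_⟩
  intro s r hs hr e e' he he' hee F hF
  have hvp := PiLp.volume_preserving_toLp (Fin (m + 1))
  have hemb := (MeasurableEquiv.toLp 2 (Fin (m + 1) → ℝ)).measurableEmbedding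
  set L := ∫⁻ h, kernelWeight s r e h *
          ∫⁻ w in {w : En (m + 1) | ⟪w, h⟫ = 0}, F w ∂μH[((m + 1 : ℕ) : ℝ) - 1] with hL
  have hgm := measurable_kernelWeight s r e
  have htoLp : Measurable (WithLp.toLp 2 : (Fin (m + 1) → ℝ) → En (m + 1)) :=
    WithLp.measurable_toLp 2 _
  set G : (Fin (m + 1) → ℝ) → (Fin (m + 1) → ℝ) → ℝ≥0∞ := fun h w =>
    kernelWeight s r e (WithLp.toLp 2 h) * F (WithLp.toLp 2 w) with hGdef
  have hG : Measurable (Function.uncurry G) :=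
    (hgm.comp (htoLp.comp measurable_fst)).mul (hF.comp (htoLp.comp measurable_snd))
  have hLj : ∀ j : Fin (m + 1), ∫⁻ h, ∫⁻ y, G h (hyperplaneGraph j h y) ≤ L := by
    intro j
    rw [hL, ← hvp.lintegral_comp_emb hemb]
    have hne : ∀ᵐ h : Fin (m + 1) → ℝ, h j ≠ 0 := by
      rw [volume_pi]
      exact Measure.ae_eval_ne (μ := fun _ : Fin (m + 1) => (volume : Measure ℝ)) j 0
    refine lintegral_mono_ae (hne.mono fun h hj => ?_)
    have hFm : Measurable fun y => F (WithLp.toLp 2 (hyperplaneGraph j h y)) :=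
      hF.comp (htoLp.comp ((measurable_hyperplaneGraph j).comp
        (measurable_const.prodMk measurable_id)))
    simp only [hGdef]
    rw [lintegral_const_mul _ hFm]
    gcongr
    exact lintegral_hyperplaneGraph_le j (h := WithLp.toLp 2 h) hj hF
  set Φ : Fin (m + 1) → Fin m → (Fin (m + 1) → ℝ) → (Fin m → ℝ) → ℝ≥0∞ := fun k i w x =>
    ENNReal.ofReal (|x i| / |w k|) * G (hyperplaneGraph k w x) w with hΦ
  have hΦm : ∀ k i, Measurable (Function.uncurry (Φ k i)) := by
    intro k i
    exact measurable_coord_div_mul_hyperplaneGraph hG k i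
  have hΦL : ∀ k i, ∫⁻ w, ∫⁻ x, Φ k i w x ≤ L := by
    intro k i
    refine le_trans (le_of_eq ?_)
      ((lintegral_hyperplaneGraph_swap (Fin.succAbove_ne k i) hG).trans (hLj _))
    refine lintegral_congr fun w => lintegral_congr fun x => ?_
    simp only [hΦ]
    congr 4
    simp [hyperplaneGraph]
  have hsum : ∫⁻ w, ∑ k, ∑ i, ∫⁻ x, Φ k i w x ≤ N * L := by
    have hm1 : ∀ k i, Measurable fun w => ∫⁻ x, Φ k i w x :=
      fun k i => Measurable.lintegral_prod_right (hΦm k i)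
    rw [lintegral_finsetSum (f := fun k w => ∑ i, ∫⁻ x, Φ k i w x) _
      (fun k _ => Finset.measurable_sum _ fun i _ => hm1 k i)]
    calc _ = ∑ k, ∑ i, ∫⁻ w, ∫⁻ x, Φ k i w x := by
          refine Finset.sum_congr rfl fun k _ => ?_
          rw [lintegral_finsetSum (f := fun i w => ∫⁻ x, Φ k i w x) _ (fun i _ => hm1 k i)]
      _ ≤ ∑ _k : Fin (m + 1), ∑ _i : Fin m, L :=
          Finset.sum_le_sum fun k _ => Finset.sum_le_sum fun i _ => hΦL k i
      _ = N * L := by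
          simp [hN]
          ring
  have hpt : ∀ w : Fin (m + 1) → ℝ, F (WithLp.toLp 2 w) * ENNReal.ofReal (c * r ^ (2 - 2 * s) *
      (⟪(WithLp.toLp 2 w : En (m + 1)), e'⟫ ^ 2 / ‖(WithLp.toLp 2 w : En (m + 1))‖ ^ 3)) ≤
      ∑ k, ∑ i, ∫⁻ x, Φ k i w x := by
    intro w
    obtain ⟨k, hk⟩ := Finite.exists_max fun i => |w i|
    by_cases hwk : w k = 0
    · have hw0 : w = 0 := by
        ext i
        have := hk i
        rw [hwk, abs_zero] at this
        simpa using this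
      simp [hw0]
    refine le_trans ?_ (Finset.single_le_sum (fun _ _ => zero_le) (Finset.mem_univ k))
    rw [← lintegral_finsetSum (f := fun i x => Φ k i w x) _
      (fun i _ => (hΦm k i).comp (measurable_const.prodMk measurable_id))]
    have hg : Measurable fun x => ENNReal.ofReal ((∑ i, |x i|) / |w k|) *
        kernelWeight s r e (WithLp.toLp 2 (hyperplaneGraph k w x)) := by
      refine Measurable.mul (by fun_prop) (hgm.comp (htoLp.comp
        ((measurable_hyperplaneGraph k).comp (measurable_const.prodMk measurable_id))))
    calc _ ≤ F (WithLp.toLp 2 w) * ∫⁻ x : Fin m → ℝ, ENNReal.ofReal ((∑ i, |x i|) / |w k|) *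
          kernelWeight s r e (WithLp.toLp 2 (hyperplaneGraph k w x)) := by
          gcongr
          exact hc' s r hs hr e e' he he' hee k (WithLp.toLp 2 w) hwk hk
      _ = ∫⁻ x, ∑ i, Φ k i w x := by
          rw [← lintegral_const_mul _ hg]
          refine lintegral_congr fun x => ?_
          simp only [hΦ, hGdef]
          rw [← Finset.sum_mul, Finset.sum_div,
            ENNReal.ofReal_sum_of_nonneg (fun i _ => by positivity)]
          ring
  have hfin := (lintegral_mono hpt).trans hsum
  rw [hvp.lintegral_comp_emb hemb (fun w : En (m + 1) => F w * ENNReal.ofReal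
    (c * r ^ (2 - 2 * s) * (⟪w, e'⟫ ^ 2 / ‖w‖ ^ 3)))] at hfin
  have h4 := mul_le_mul_right hfin (ENNReal.ofReal (1 / N))
  rw [← mul_assoc, ← ENNReal.ofReal_natCast N, ← ENNReal.ofReal_mul (by positivity),
    one_div_mul_cancel hN0.ne', ENNReal.ofReal_one, one_mul] at h4
  refine le_trans (le_of_eq ?_) h4
  rw [← lintegral_const_mul' _ _ ENNReal.ofReal_ne_top]
  refine lintegral_congr fun w => ?_
  rw [mul_left_comm, ← ENNReal.ofReal_mul (by positivity)]
  congr 2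
  ring

/-- The annulus around `v` with radii comparable to `1 + |v|`. -/
def velocityAnnulus {n : ℕ} (δ R : ℝ) (v : En n) : Set (En n) :=
  {z | δ * (1 + ‖v‖) ≤ ‖z - v‖ ∧ ‖z - v‖ ≤ (R + 1) * (1 + ‖v‖)}

theorem measurableSet_velocityAnnulus {n : ℕ} (δ R : ℝ) (v : En n) :
    MeasurableSet (velocityAnnulus δ R v) := by
  have h : Measurable fun z : En n => ‖z - v‖ := by fun_prop
  exact (measurableSet_le measurable_const h).inter (measurableSet_le h measurable_const)

theorem norm_sub_le_of_norm_le {n : ℕ} {R : ℝ} (hR : 0 ≤ R) {z v : En n} (hz : ‖z‖ ≤ R) :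
    ‖z - v‖ ≤ (R + 1) * (1 + ‖v‖) := by
  nlinarith [norm_sub_le z v, norm_nonneg v, mul_nonneg hR (norm_nonneg v)]

theorem abs_inner_le_of_norm_eq_one {n : ℕ} {b : En n} (hb : ‖b‖ = 1) (z : En n) :
    |⟪z, b⟫| ≤ ‖z‖ := by
  simpa [hb] using abs_real_inner_le_norm z b

theorem measure_closedBall_ge {n : ℕ} {m₀ Mq q R : ℝ} (hm₀ : 0 < m₀) (hR : 1 ≤ R) (hq : 0 < q)
    (hMR : Mq / (m₀ / 2) ≤ R ^ q) {ν : Measure (En n)} (hν : ENNReal.ofReal m₀ ≤ ν univ)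
    (hνq : ∫⁻ z, ENNReal.ofReal (‖z‖ ^ q) ∂ν ≤ ENNReal.ofReal Mq) :
    ENNReal.ofReal (m₀ / 2) ≤ ν (closedBall 0 R) := by
  have hRq : 0 < R ^ q := by positivity
  have h1 : ENNReal.ofReal (R ^ q) * ν (closedBall 0 R)ᶜ ≤ ENNReal.ofReal Mq := by
    refine le_trans ?_ ((mul_meas_ge_le_lintegral (μ := ν)
      (f := fun z : En n => ENNReal.ofReal (‖z‖ ^ q)) (by fun_prop) (ENNReal.ofReal (R ^ q))).trans hνq)
    gcongr
    intro z hz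
    simp only [mem_compl_iff, mem_closedBall_zero_iff, not_le] at hz
    exact ENNReal.ofReal_le_ofReal (Real.rpow_le_rpow (by linarith) hz.le hq.le)
  have h2 : ν (closedBall 0 R)ᶜ ≤ ENNReal.ofReal (m₀ / 2) := by
    have h3 := h1.trans (ENNReal.ofReal_le_ofReal ((div_le_iff₀ (by positivity)).1 hMR))
    rw [ENNReal.ofReal_mul hRq.le] at h3
    exact (ENNReal.mul_le_mul_iff_right (by simpa using hRq) ENNReal.ofReal_ne_top).1 h3
  have h3 : ENNReal.ofReal (m₀ / 2) + ENNReal.ofReal (m₀ / 2) ≤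
      ν (closedBall 0 R) + ENNReal.ofReal (m₀ / 2) := by
    rw [← ENNReal.ofReal_add (by positivity) (by positivity), add_halves]
    refine hν.trans ?_
    rw [← measure_add_measure_compl (μ := ν) (measurableSet_closedBall (x := (0 : En n)) (ε := R))]
    gcongr
  exact (ENNReal.add_le_add_iff_right ENNReal.ofReal_ne_top).1 h3

theorem exists_truncated_variance {m₀ M p₀ Mq q : ℝ} (hm₀ : 0 < m₀) (hM : 0 < M) (hp₀ : 0 < p₀)
    (hq : 2 < q) :
    ∃ R δ c : ℝ, 1 ≤ R ∧ 0 < δ ∧ δ ≤ 1 ∧ 0 < c ∧ ∀ (n : ℕ) (ν : Measure (En n)),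
      ENNReal.ofReal m₀ ≤ ν univ → ν univ ≤ ENNReal.ofReal M →
      ∫⁻ z, ENNReal.ofReal (‖z‖ ^ q) ∂ν ≤ ENNReal.ofReal Mq →
      ∀ b v : En n, ‖b‖ = 1 → ENNReal.ofReal p₀ ≤ ∫⁻ z, ENNReal.ofReal (⟪z - v, b⟫ ^ 2) ∂ν →
        ENNReal.ofReal c ≤
          ∫⁻ z in velocityAnnulus δ R v, ENNReal.ofReal (⟪z - v, b⟫ ^ 2) ∂ν := by
  obtain ⟨R₁, hR₁M, hR₁⟩ := (((tendsto_rpow_atTop (by linarith : 0 < q)).eventually_ge_atTop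
    (Mq / (m₀ / 2))).and (Filter.eventually_ge_atTop 1)).exists
  obtain ⟨R, hRM, hRR₁⟩ := (((tendsto_rpow_atTop (by linarith : 0 < q - 2)).eventually_ge_atTop
    (16 * Mq / p₀)).and (Filter.eventually_ge_atTop (R₁ + 1))).exists
  have hR : 1 ≤ R := by linarith
  set d := min 1 (p₀ / (4 * M)) with hd
  have hd0 : 0 < d := lt_min one_pos (by positivity)
  have hd1 : d ≤ 1 := min_le_left _ _
  have hdM : d ^ 2 * M ≤ p₀ / 4 := by
    have h1 : d * M ≤ p₀ / 4 := by
      have := mul_le_mul_of_nonneg_right (min_le_right 1 (p₀ / (4 * M))) hM.le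
      refine this.trans (le_of_eq ?_)
      field_simp
    nlinarith [mul_pos hd0 hM]
  set δ := d / (2 * R + 2) with hδ
  have hδ0 : 0 < δ := by positivity
  have hδd : δ * (2 * R + 2) = d := by
    rw [hδ]
    field_simp
  have hδ4 : δ ≤ 1 / 4 := by nlinarith
  refine ⟨R, δ, min (m₀ / 2) (p₀ / 2), hR, hδ0, by linarith, by positivity, ?_⟩
  intro n ν hνm hνM hνq b v hb hp
  have hfar : ∀ z : En n, ‖z‖ ≤ R → 2 * R + 1 ≤ ‖v‖ → δ * (1 + ‖v‖) ≤ ‖z - v‖ := by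
    intro z hz hv
    have h1 : ‖v‖ - ‖z‖ ≤ ‖z - v‖ := by
      rw [norm_sub_rev]
      exact norm_sub_norm_le v z
    nlinarith [norm_nonneg v]
  by_cases hT : R₁ + 1 ≤ |⟪v, b⟫|
  · have hge : ∀ z ∈ closedBall (0 : En n) R₁, 1 ≤ |⟪z - v, b⟫| := by
      intro z hz
      rw [mem_closedBall_zero_iff] at hz
      have h1 := abs_inner_le_of_norm_eq_one hb z
      have h2 := abs_sub_abs_le_abs_sub ⟪v, b⟫ ⟪z, b⟫
      rw [inner_sub_left, abs_sub_comm]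
      linarith
    have hsub : closedBall (0 : En n) R₁ ⊆ velocityAnnulus δ R v := by
      intro z hz
      have h1 := hge z hz
      have h2 := abs_inner_le_of_norm_eq_one hb (z - v)
      rw [mem_closedBall_zero_iff] at hz
      refine ⟨?_, norm_sub_le_of_norm_le (by linarith) (by linarith)⟩
      rcases le_total (2 * R + 1) ‖v‖ with hv | hv
      · exact hfar z (by linarith) hv
      · nlinarith
    calc ENNReal.ofReal (min (m₀ / 2) (p₀ / 2)) ≤ ENNReal.ofReal (m₀ / 2) :=
          ENNReal.ofReal_le_ofReal (min_le_left _ _)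
      _ ≤ ν (closedBall 0 R₁) := measure_closedBall_ge hm₀ hR₁ (by linarith) hR₁M hνm hνq
      _ = ∫⁻ z in closedBall 0 R₁, 1 ∂ν := by simp
      _ ≤ ∫⁻ z in closedBall 0 R₁, ENNReal.ofReal (⟪z - v, b⟫ ^ 2) ∂ν := by
          refine setLIntegral_mono' measurableSet_closedBall fun z hz => ?_
          rw [← ENNReal.ofReal_one, ← sq_abs]
          exact ENNReal.ofReal_le_ofReal (one_le_pow₀ (hge z hz))
      _ ≤ _ := lintegral_mono_set hsub
  · push Not at hT
    set tail : Set (En n) := {z | R < ‖z‖}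
    set near : Set (En n) := {z | ‖z‖ ≤ R ∧ ‖z - v‖ < δ * (1 + ‖v‖)}
    have htm : MeasurableSet tail := measurableSet_lt measurable_const measurable_norm
    have hnm : MeasurableSet near := by
      have h : Measurable fun z : En n => ‖z - v‖ := by fun_prop
      exact (measurableSet_le measurable_norm measurable_const).inter
        (measurableSet_lt h measurable_const)
    have hcover : (univ : Set (En n)) ⊆ (velocityAnnulus δ R v ∪ tail) ∪ near := by
      intro z _
      by_cases h1 : R < ‖z‖
      · exact Or.inl (Or.inr h1)
      push Not at h1
      by_cases h2 : ‖z - v‖ < δ * (1 + ‖v‖)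
      · exact Or.inr ⟨h1, h2⟩
      push Not at h2
      exact Or.inl (Or.inl ⟨h2, norm_sub_le_of_norm_le (by linarith) h1⟩)
    have hR0 : 0 < R := by linarith
    have htail : ∫⁻ z in tail, ENNReal.ofReal (⟪z - v, b⟫ ^ 2) ∂ν ≤ ENNReal.ofReal (p₀ / 4) := by
      calc _ ≤ ∫⁻ z in tail, ENNReal.ofReal (4 * R ^ (2 - q)) * ENNReal.ofReal (‖z‖ ^ q) ∂ν := by
            refine setLIntegral_mono' htm fun z (hz : R < ‖z‖) => ?_
            rw [← ENNReal.ofReal_mul (by positivity)]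
            refine ENNReal.ofReal_le_ofReal ?_
            have hz0 : 0 < ‖z‖ := hR0.trans hz
            have h1 : |⟪z - v, b⟫| ≤ 2 * ‖z‖ := by
              rw [inner_sub_left]
              have h2 := abs_inner_le_of_norm_eq_one hb z
              have h3 := abs_sub ⟪z, b⟫ ⟪v, b⟫
              linarith
            have h4 : ⟪z - v, b⟫ ^ 2 ≤ (2 * ‖z‖) ^ 2 := by
              rw [← sq_abs]
              gcongr
            have h5 : ‖z‖ ^ 2 = ‖z‖ ^ (2 - q) * ‖z‖ ^ q := by
              rw [← Real.rpow_add hz0, sub_add_cancel, Real.rpow_ofNat]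
            have h6 : ‖z‖ ^ (2 - q) ≤ R ^ (2 - q) :=
              Real.rpow_le_rpow_of_nonpos hR0 hz.le (by linarith)
            calc _ ≤ 4 * (‖z‖ ^ (2 - q) * ‖z‖ ^ q) := by
                  rw [← h5]
                  linarith
              _ ≤ 4 * (R ^ (2 - q) * ‖z‖ ^ q) := by gcongr
              _ = _ := by ring
        _ ≤ ENNReal.ofReal (4 * R ^ (2 - q)) * ENNReal.ofReal Mq := by
            rw [lintegral_const_mul' _ _ ENNReal.ofReal_ne_top]
            gcongr
            exact (setLIntegral_le_lintegral _ _).trans hνq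
        _ ≤ _ := by
            rw [← ENNReal.ofReal_mul (by positivity)]
            refine ENNReal.ofReal_le_ofReal ?_
            have h1 : 2 - q = -(q - 2) := by ring
            rw [h1, Real.rpow_neg hR0.le]
            have h2 : 0 < R ^ (q - 2) := by positivity
            rw [div_le_iff₀ hp₀] at hRM
            have h3 : 4 * (R ^ (q - 2))⁻¹ * Mq = 4 * Mq / R ^ (q - 2) := by ring
            rw [h3, div_le_iff₀ h2]
            nlinarith
    have hnear : ∫⁻ z in near, ENNReal.ofReal (⟪z - v, b⟫ ^ 2) ∂ν ≤ ENNReal.ofReal (p₀ / 4) := by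
      calc _ ≤ ∫⁻ z in near, ENNReal.ofReal (d ^ 2) ∂ν := by
            refine setLIntegral_mono' hnm fun z hz => ?_
            refine ENNReal.ofReal_le_ofReal ?_
            have h1 := abs_inner_le_of_norm_eq_one hb (z - v)
            have hv : ‖v‖ ≤ 2 * R + 1 := by
              by_contra! h
              linarith [hfar z hz.1 h.le, hz.2]
            have h2 : |⟪z - v, b⟫| ≤ d := by nlinarith [hz.2]
            rw [← sq_abs]
            gcongr
        _ ≤ ENNReal.ofReal (d ^ 2) * ENNReal.ofReal M := by
            rw [setLIntegral_const]
            gcongr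
            exact (measure_mono (subset_univ _)).trans hνM
        _ ≤ _ := by
            rw [← ENNReal.ofReal_mul (by positivity)]
            exact ENNReal.ofReal_le_ofReal hdM
    set I := ∫⁻ z in velocityAnnulus δ R v, ENNReal.ofReal (⟪z - v, b⟫ ^ 2) ∂ν
    have htot : ENNReal.ofReal (p₀ / 2) + ENNReal.ofReal (p₀ / 2) ≤
        I + ENNReal.ofReal (p₀ / 2) := by
      calc _ = ENNReal.ofReal p₀ := by
            rw [← ENNReal.ofReal_add (by positivity) (by positivity), add_halves]
        _ ≤ ∫⁻ z in (univ : Set (En n)), ENNReal.ofReal (⟪z - v, b⟫ ^ 2) ∂ν := by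
            rwa [setLIntegral_univ]
        _ ≤ ∫⁻ z in (velocityAnnulus δ R v ∪ tail) ∪ near, ENNReal.ofReal (⟪z - v, b⟫ ^ 2) ∂ν :=
            lintegral_mono_set hcover
        _ ≤ I + ENNReal.ofReal (p₀ / 4) + ENNReal.ofReal (p₀ / 4) := by
            refine (lintegral_union_le _ _ _).trans (add_le_add ?_ hnear)
            exact (lintegral_union_le _ _ _).trans (add_le_add le_rfl htail)
        _ = _ := by
            rw [add_assoc, ← ENNReal.ofReal_add (by positivity) (by positivity)]
            congr 2
            ring
    exact (ENNReal.ofReal_le_ofReal (min_le_right _ _)).trans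
      ((ENNReal.add_le_add_iff_right ENNReal.ofReal_ne_top).1 htot)

theorem mul_rpow_le_norm_rpow {n : ℕ} {γ₀ α δ R : ℝ} (hδ : 0 < δ) (hδ1 : δ ≤ 1) (hR : 0 ≤ R)
    (hα : -(n : ℝ) - 2 ≤ α) (hαγ : α ≤ γ₀) {v z : En n} (hz : z ∈ velocityAnnulus δ R v) :
    δ ^ |γ₀| * (R + 1) ^ (-(n : ℝ) - 2) * (1 + ‖v‖) ^ α ≤ ‖z - v‖ ^ α := by
  obtain ⟨h1, h2⟩ := hz
  have hv : 0 < 1 + ‖v‖ := by positivity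
  have hzv : 0 < ‖z - v‖ := lt_of_lt_of_le (by positivity) h1
  have hδ' : δ ^ |γ₀| ≤ 1 := Real.rpow_le_one hδ.le hδ1 (abs_nonneg _)
  have hR' : (R + 1) ^ (-(n : ℝ) - 2) ≤ 1 :=
    Real.rpow_le_one_of_one_le_of_nonpos (by linarith) (by linarith [(Nat.cast_nonneg n : (0:ℝ) ≤ n)])
  rcases le_total 0 α with h | h
  · calc _ ≤ δ ^ α * 1 * (1 + ‖v‖) ^ α := by
          gcongr ?_ * ?_ * _
          exact Real.rpow_le_rpow_of_exponent_ge hδ hδ1 (hαγ.trans (le_abs_self _))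
      _ = (δ * (1 + ‖v‖)) ^ α := by rw [mul_one, Real.mul_rpow hδ.le hv.le]
      _ ≤ _ := by gcongr
  · calc _ ≤ 1 * (R + 1) ^ α * (1 + ‖v‖) ^ α := by
          gcongr ?_ * ?_ * _
          exact Real.rpow_le_rpow_of_exponent_le (by linarith) hα
      _ = ((R + 1) * (1 + ‖v‖)) ^ α := by rw [one_mul, Real.mul_rpow (by linarith) hv.le]
      _ ≤ _ := Real.rpow_le_rpow_of_nonpos hzv h2 h

theorem integrable_mul_norm_sq {n : ℕ} {f : En n → ℝ} {q M₀ Mq : ℝ} (hf : Measurable f)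
    (hf0 : ∀ v, 0 ≤ f v) (hq : 2 < q) (hM : ∫⁻ v, ENNReal.ofReal (f v) ≤ ENNReal.ofReal M₀)
    (hMq : MomentBound f q Mq) : Integrable f ∧ Integrable fun z => f z * ‖z‖ ^ 2 := by
  have h1 : Integrable f := by
    refine ⟨hf.aestronglyMeasurable, ?_⟩
    rw [hasFiniteIntegral_iff_ofReal (Filter.Eventually.of_forall hf0)]
    exact hM.trans_lt ENNReal.ofReal_lt_top
  have h2 : Integrable fun z => f z * ‖z‖ ^ q := by
    refine ⟨by fun_prop, ?_⟩
    rw [hasFiniteIntegral_iff_ofReal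
      (Filter.Eventually.of_forall fun z => mul_nonneg (hf0 z) (by positivity))]
    exact lt_of_le_of_lt hMq ENNReal.ofReal_lt_top
  refine ⟨h1, (h1.add h2).mono' (by fun_prop) (Filter.Eventually.of_forall fun z => ?_)⟩
  rw [Real.norm_of_nonneg (mul_nonneg (hf0 z) (by positivity))]
  have h3 : ‖z‖ ^ 2 ≤ 1 + ‖z‖ ^ q := by
    rcases le_total ‖z‖ 1 with h | h
    · have := pow_le_one₀ (n := 2) (norm_nonneg z) h
      have : 0 ≤ ‖z‖ ^ q := by positivity
      linarith
    · have := Real.rpow_le_rpow_of_exponent_le h hq.le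
      rw [Real.rpow_ofNat] at this
      linarith
  have := mul_le_mul_of_nonneg_left h3 (hf0 z)
  simp only [Pi.add_apply]
  linarith

/-- Among all centres, the directional second moment is smallest at the mean velocity. -/
theorem lintegral_sq_inner_vbar_le {n : ℕ} {f : En n → ℝ} (hf : Measurable f)
    (hf0 : ∀ v, 0 ≤ f v) (hfi : Integrable f) (hf2 : Integrable fun z => f z * ‖z‖ ^ 2)
    (hm : 0 < ∫ z, f z) (b v : En n) :
    ∫⁻ w, ENNReal.ofReal (f (vbar f + w) * ⟪w, b⟫ ^ 2) ≤
      ∫⁻ z, ENNReal.ofReal (f z * ⟪z - v, b⟫ ^ 2) := by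
  have hfv : Integrable fun z => f z • z := by
    refine (hfi.add hf2).mono' (by fun_prop) (Filter.Eventually.of_forall fun z => ?_)
    rw [norm_smul, Real.norm_of_nonneg (hf0 z)]
    simp only [Pi.add_apply]
    nlinarith [mul_nonneg (hf0 z) (sq_nonneg (‖z‖ - 1)), mul_nonneg (hf0 z) (norm_nonneg z), hf0 z]
  have hX : Integrable fun z => f z * ⟪z, b⟫ := by
    simpa [inner_smul_left] using hfv.inner_const (𝕜 := ℝ) b
  have hX2 : Integrable fun z => f z * ⟪z, b⟫ ^ 2 := by
    refine (hf2.mul_const (‖b‖ ^ 2)).mono' (by fun_prop) (Filter.Eventually.of_forall fun z => ?_)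
    rw [Real.norm_of_nonneg (mul_nonneg (hf0 z) (by positivity)), mul_assoc, ← mul_pow,
      ← sq_abs ⟪z, b⟫]
    have := abs_real_inner_le_norm z b
    have := hf0 z
    gcongr
  have hexp : ∀ u : En n, (fun z => f z * ⟪z - u, b⟫ ^ 2) = fun z =>
      f z * ⟪z, b⟫ ^ 2 - 2 * ⟪u, b⟫ * (f z * ⟪z, b⟫) + ⟪u, b⟫ ^ 2 * f z := by
    intro u
    ext z
    rw [inner_sub_left]
    ring
  have hint : ∀ u : En n, Integrable fun z => f z * ⟪z - u, b⟫ ^ 2 := by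
    intro u
    rw [hexp]
    exact (hX2.sub (hX.const_mul _)).add (hfi.const_mul _)
  have hval : ∀ u : En n, ∫ z, f z * ⟪z - u, b⟫ ^ 2 = (∫ z, f z * ⟪z, b⟫ ^ 2) -
      2 * ⟪u, b⟫ * (∫ z, f z * ⟪z, b⟫) + ⟪u, b⟫ ^ 2 * ∫ z, f z := by
    intro u
    have h1 : Integrable fun z => f z * ⟪z, b⟫ ^ 2 - 2 * ⟪u, b⟫ * (f z * ⟪z, b⟫) :=
      hX2.sub (hX.const_mul _)
    rw [hexp, integral_add h1 (hfi.const_mul _), integral_sub hX2 (hX.const_mul _),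
      integral_const_mul, integral_const_mul]
  have hS : ∫ z, f z * ⟪z, b⟫ = ⟪vbar f, b⟫ * ∫ z, f z := by
    have h1 : ∫ z, ⟪b, f z • z⟫ = ⟪b, ∫ z, f z • z⟫ := integral_inner hfv b
    have h2 : ∀ z, f z * ⟪z, b⟫ = ⟪b, f z • z⟫ := fun z => by
      rw [inner_smul_right, real_inner_comm]
    simp_rw [h2]
    rw [h1, vbar, inner_smul_left, real_inner_comm]
    simp only [conj_trivial]
    field_simp
  have hof : ∀ u : En n, ∫⁻ z, ENNReal.ofReal (f z * ⟪z - u, b⟫ ^ 2) =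
      ENNReal.ofReal (∫ z, f z * ⟪z - u, b⟫ ^ 2) := fun u =>
    (ofReal_integral_eq_lintegral_ofReal (hint u)
      (Filter.Eventually.of_forall fun z => mul_nonneg (hf0 z) (sq_nonneg _))).symm
  have htrans : ∫⁻ w, ENNReal.ofReal (f (vbar f + w) * ⟪w, b⟫ ^ 2) =
      ∫⁻ z, ENNReal.ofReal (f z * ⟪z - vbar f, b⟫ ^ 2) := by
    simpa using lintegral_add_left_eq_self (μ := volume)
      (fun z => ENNReal.ofReal (f z * ⟪z - vbar f, b⟫ ^ 2)) (vbar f)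
  rw [htrans, hof, hof, hval, hval, hS]
  refine ENNReal.ofReal_le_ofReal ?_
  nlinarith [mul_nonneg hm.le (sq_nonneg (⟪v, b⟫ - ⟪vbar f, b⟫))]

theorem lintegral_ball_KfE {m : ℕ} (s γ r : ℝ) (f : En (m + 1) → ℝ) (v e : En (m + 1)) :
    ∫⁻ h in ball (0 : En (m + 1)) r,
        KfE (m + 1) s γ f v (v + h) * ENNReal.ofReal (max ⟪h, e⟫ 0 ^ 2) =
      ∫⁻ h, kernelWeight s r e h * ∫⁻ w in {w : En (m + 1) | ⟪w, h⟫ = 0},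
        ENNReal.ofReal (f (v + w) * ‖w‖ ^ (γ + 2 * s + 1)) ∂μH[((m + 1 : ℕ) : ℝ) - 1] := by
  rw [← lintegral_indicator measurableSet_ball]
  refine lintegral_congr fun h => ?_
  by_cases hh : h ∈ ball (0 : En (m + 1)) r
  · simp only [kernelWeight, KfE, indicator_of_mem hh, add_sub_cancel_left]
    ring
  · simp [kernelWeight, indicator_of_notMem hh]

/-- Proposition 4.2 of the paper: nondegeneracy of the Boltzmann kernel.
Under mass, pressure, and `q`-moment bounds (`q > 2`), for all `r > 0`, `v ∈ ℝⁿ` and unit `e`,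
`∫_{B_r} K_f(v,v+h) (h·e)₊² dh ≥ c (1+|v|)^{γ+2s-2} r^{2-2s}`, with `c` depending only on
`n, m₀, M₀, p₀, M_q, q, γ₀` (independent of `s` and `v`). -/
theorem stmt8 (n : ℕ) (hn : 2 ≤ n) (γ₀ m₀ M₀ p₀ Mq q : ℝ)
    (hγ₀ : -(n : ℝ) < γ₀) (hm₀ : 0 < m₀) (hp₀ : 0 < p₀) (hq : 2 < q) :
    ∃ c : ℝ, 0 < c ∧
      ∀ s γ : ℝ, s ∈ Set.Ioo (0:ℝ) 1 → -(n : ℝ) < γ → γ ≤ γ₀ →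
        ∀ f : En n → ℝ, Measurable f → (∀ v, 0 ≤ f v) →
          MassBound f m₀ M₀ → PressureLB f p₀ → MomentBound f q Mq →
          ∀ (r : ℝ) (v e : En n), 0 < r → ‖e‖ = 1 →
            ENNReal.ofReal (c * (1 + ‖v‖) ^ (γ + 2*s - 2) * r ^ (2 - 2*s)) ≤
              ∫⁻ h in Metric.ball (0 : En n) r,
                KfE n s γ f v (v + h) * ENNReal.ofReal (max ⟪h, e⟫ 0 ^ 2) := by
  obtain ⟨m, rfl⟩ : ∃ m, n = m + 1 := ⟨n - 1, by omega⟩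
  obtain ⟨c₀, hc₀, hgeom⟩ := exists_lintegral_kernelWeight_hyperplane_ge (m := m) (by omega)
  obtain ⟨R, δ, c₁, hR, hδ, hδ1, hc₁, hvar⟩ := exists_truncated_variance hm₀
    (by positivity : 0 < |M₀| + 1) (half_pos hp₀) (Mq := Mq) hq
  set c₂ := δ ^ |γ₀| * (R + 1) ^ (-((m + 1 : ℕ) : ℝ) - 2) with hc₂
  have hc₂0 : 0 < c₂ := by positivity
  refine ⟨c₀ * c₂ * c₁, by positivity, ?_⟩
  intro s γ hs hγ hγ1 f hf hf0 hmass hpress hmom r v e hr he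
  obtain ⟨b, hb, hbe, hpb⟩ := hpress e he (p₀ / 2) (half_pos hp₀)
  obtain ⟨hfi, hf2⟩ := integrable_mul_norm_sq hf hf0 hq hmass.2 hmom
  have hm : 0 < ∫ z, f z := by
    have h1 := hmass.1
    rw [← ofReal_integral_eq_lintegral_ofReal hfi (Filter.Eventually.of_forall hf0)] at h1
    exact ENNReal.ofReal_pos.1 ((ENNReal.ofReal_pos.2 hm₀).trans_le h1)
  set ν : Measure (En (m + 1)) := volume.withDensity fun z => ENNReal.ofReal (f z) with hν
  have hfm : Measurable fun z => ENNReal.ofReal (f z) := by fun_prop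
  have hνint : ∀ (A : Set (En (m + 1))), MeasurableSet A → ∀ g : En (m + 1) → ℝ, Measurable g →
      ∫⁻ z in A, ENNReal.ofReal (g z) ∂ν = ∫⁻ z in A, ENNReal.ofReal (f z * g z) := by
    intro A hA g hg
    rw [hν, setLIntegral_withDensity_eq_setLIntegral_mul _ hfm (by fun_prop) hA]
    refine lintegral_congr fun z => ?_
    rw [Pi.mul_apply, ENNReal.ofReal_mul (hf0 z)]
  have hνuniv : ν univ = ∫⁻ z, ENNReal.ofReal (f z) := by
    rw [hν, withDensity_apply _ MeasurableSet.univ, setLIntegral_univ]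
  have hannulus : ENNReal.ofReal c₁ ≤
      ∫⁻ z in velocityAnnulus δ R v, ENNReal.ofReal (f z * ⟪z - v, b⟫ ^ 2) := by
    rw [← hνint _ (measurableSet_velocityAnnulus δ R v) _ (by fun_prop)]
    refine hvar (m + 1) ν ?_ ?_ ?_ b v hb ?_
    · rw [hνuniv]
      exact hmass.1
    · rw [hνuniv]
      exact hmass.2.trans (ENNReal.ofReal_le_ofReal (by linarith [le_abs_self M₀]))
    · rw [← setLIntegral_univ, hνint _ MeasurableSet.univ _ (by fun_prop), setLIntegral_univ]
      exact hmom
    · rw [← setLIntegral_univ, hνint _ MeasurableSet.univ _ (by fun_prop), setLIntegral_univ]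
      refine le_trans ?_ (lintegral_sq_inner_vbar_le hf hf0 hfi hf2 hm b v)
      rwa [sub_half] at hpb
  rw [lintegral_ball_KfE]
  refine le_trans ?_ (hgeom s r hs hr e b he hb hbe
    (fun w => ENNReal.ofReal (f (v + w) * ‖w‖ ^ (γ + 2 * s + 1))) (by fun_prop))
  have htrans : ∫⁻ w, ENNReal.ofReal (f (v + w) * ‖w‖ ^ (γ + 2 * s + 1)) *
        ENNReal.ofReal (c₀ * r ^ (2 - 2 * s) * (⟪w, b⟫ ^ 2 / ‖w‖ ^ 3)) =
      ∫⁻ z, ENNReal.ofReal (f z * ‖z - v‖ ^ (γ + 2 * s + 1)) *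
        ENNReal.ofReal (c₀ * r ^ (2 - 2 * s) * (⟪z - v, b⟫ ^ 2 / ‖z - v‖ ^ 3)) := by
    simpa using lintegral_add_left_eq_self (μ := volume)
      (fun z => ENNReal.ofReal (f z * ‖z - v‖ ^ (γ + 2 * s + 1)) *
        ENNReal.ofReal (c₀ * r ^ (2 - 2 * s) * (⟪z - v, b⟫ ^ 2 / ‖z - v‖ ^ 3))) v
  rw [htrans]
  calc ENNReal.ofReal (c₀ * c₂ * c₁ * (1 + ‖v‖) ^ (γ + 2*s - 2) * r ^ (2 - 2*s))
      = ENNReal.ofReal (c₀ * c₂ * (1 + ‖v‖) ^ (γ + 2*s - 2) * r ^ (2 - 2*s)) *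
          ENNReal.ofReal c₁ := by
        rw [← ENNReal.ofReal_mul (by positivity)]
        congr 1
        ring
    _ ≤ ∫⁻ z in velocityAnnulus δ R v,
          ENNReal.ofReal (c₀ * c₂ * (1 + ‖v‖) ^ (γ + 2*s - 2) * r ^ (2 - 2*s)) *
            ENNReal.ofReal (f z * ⟪z - v, b⟫ ^ 2) := by
        rw [lintegral_const_mul' _ _ ENNReal.ofReal_ne_top]
        gcongr
    _ ≤ ∫⁻ z in velocityAnnulus δ R v, ENNReal.ofReal (f z * ‖z - v‖ ^ (γ + 2 * s + 1)) *
          ENNReal.ofReal (c₀ * r ^ (2 - 2 * s) * (⟪z - v, b⟫ ^ 2 / ‖z - v‖ ^ 3)) := by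
        refine setLIntegral_mono' (measurableSet_velocityAnnulus δ R v) fun z hz => ?_
        have hfz := hf0 z
        rw [← ENNReal.ofReal_mul (by positivity), ← ENNReal.ofReal_mul (by positivity)]
        refine ENNReal.ofReal_le_ofReal ?_
        have hzv : 0 < ‖z - v‖ := lt_of_lt_of_le (by positivity) hz.1
        have h1 : ‖z - v‖ ^ (γ + 2 * s + 1) = ‖z - v‖ ^ (γ + 2 * s - 2) * ‖z - v‖ ^ 3 := by
          rw [← Real.rpow_natCast ‖z - v‖ 3, ← Real.rpow_add hzv]
          congr 1
          push_cast
          ring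
        have h2 := mul_rpow_le_norm_rpow hδ hδ1 (zero_le_one.trans hR) (γ₀ := γ₀) (α := γ + 2 * s - 2)
          (by linarith [hs.1]) (by linarith [hs.2]) hz
        calc c₀ * c₂ * (1 + ‖v‖) ^ (γ + 2*s - 2) * r ^ (2 - 2*s) * (f z * ⟪z - v, b⟫ ^ 2)
            = c₀ * r ^ (2 - 2*s) * (f z * ⟪z - v, b⟫ ^ 2) *
                (c₂ * (1 + ‖v‖) ^ (γ + 2*s - 2)) := by ring
          _ ≤ c₀ * r ^ (2 - 2*s) * (f z * ⟪z - v, b⟫ ^ 2) * ‖z - v‖ ^ (γ + 2 * s - 2) := by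
              gcongr
          _ = _ := by
              rw [h1]
              field_simp
    _ ≤ _ := setLIntegral_le_lintegral _ _
end
end
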